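/- In the spectrahedral regression model with Gaussian design, let ξ^(i) = (X^(i),1) ∈ ℝ^{d+1} with X^(i) i.i.d. standard Gaussian in ℝ^d, let ε ∈ ℝ^n have i.i.d. N(0,σ²) entries independent of the design, and let 𝒜_* ∈ (𝕊^m)^{d+1} satisfy the spectral gap condition inf_{‖u‖=1} λ_1(𝒜_*[u]) − λ_2(𝒜_*[u]) = κ > 0. For 𝒜 in the ball B(𝒜_*, κ/4) = { 𝒜 : ‖𝒜 − 𝒜_*‖_F ≤ κ/4 }, let Ξ_𝒜 ∈ ℝ^{n × (d+1)m²} be the matrix with rows ξ^(i) ⊗ U^(i), where U^(i) = u^(i)(u^(i))^T and u^(i) is a unit top eigenvector of 𝒜[ξ^(i)], and let P_{Ξ_𝒜} be the orthogonal projection onto the column span of Ξ_𝒜; set 𝒫 = { P_{Ξ_𝒜} : 𝒜 ∈ B(𝒜_*, κ/4) }. Then there exist absolute constants c_0, c_1, c_2 > 0 such that for n ≥ c_0, P( sup_{P ∈ 𝒫} ‖P ε‖² ≥ c_1 (log n)² σ² m² (d+1) ) ≤ exp( −c_2 (d+1) m² log n ). -/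

import Mathlib

open MeasureTheory ProbabilityTheory Matrix
open scoped BigOperators NNReal

noncomputable section

/-- The quadratic form `v ↦ vᵀ A v`. -/
def rayleigh {m : ℕ} (A : Matrix (Fin m) (Fin m) ℝ) (v : Fin m → ℝ) : ℝ :=
  ∑ i, ∑ j, v i * A i j * v j

/-- The largest eigenvalue of a symmetric matrix. -/
def lambdaMax {m : ℕ} (A : Matrix (Fin m) (Fin m) ℝ) : ℝ :=
  sSup {r : ℝ | ∃ v : Fin m → ℝ, (∑ i, v i ^ 2) = 1 ∧ r = rayleigh A v}

/-- The second largest eigenvalue of a symmetric matrix, via Courant–Fischer. -/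
def lambda2 {m : ℕ} (A : Matrix (Fin m) (Fin m) ℝ) : ℝ :=
  sInf {s : ℝ | ∃ w : Fin m → ℝ,
    s = sSup {r : ℝ | ∃ v : Fin m → ℝ,
      (∑ i, v i ^ 2) = 1 ∧ (∑ i, v i * w i) = 0 ∧ r = rayleigh A v}}

/-- The linear pencil `𝒜[x] = ∑ i, x i • A i`. -/
def pencil {m q : ℕ} (A : Fin q → Matrix (Fin m) (Fin m) ℝ) (x : Fin q → ℝ) :
    Matrix (Fin m) (Fin m) ℝ := ∑ i, x i • A i

/-- Frobenius norm of a tuple of matrices. -/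
def frobP {m q : ℕ} (A : Fin q → Matrix (Fin m) (Fin m) ℝ) : ℝ :=
  Real.sqrt (∑ i, ∑ j, ∑ l, (A i j l) ^ 2)

/-- The matrix `Ξ` with rows `ξ⁽ⁱ⁾ ⊗ U⁽ⁱ⁾` where `U⁽ⁱ⁾ = u⁽ⁱ⁾ (u⁽ⁱ⁾)ᵀ`. -/
def XiMat {d m n : ℕ} (xi : Fin n → Fin (d + 1) → ℝ) (u : Fin n → Fin m → ℝ) :
    Matrix (Fin n) (Fin (d + 1) × Fin m × Fin m) ℝ :=
  Matrix.of fun i p => xi i p.1 * (u i p.2.1 * u i p.2.2)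

lemma hasFDerivAt_eval_mvPolynomial {ι : Type*} [Fintype ι] (P : MvPolynomial ι ℝ) (x : ι → ℝ) :
    HasFDerivAt (fun y : ι → ℝ => MvPolynomial.eval y P)
      (∑ i, MvPolynomial.eval x (MvPolynomial.pderiv i P) •
        (ContinuousLinearMap.proj i : (ι → ℝ) →L[ℝ] ℝ)) x := by
  classical
  induction P using MvPolynomial.induction_on with
  | C a => simpa using hasFDerivAt_const a x
  | add p q hp hq =>
    have e : (fun y : ι → ℝ => MvPolynomial.eval y (p + q)) =
        (fun y => MvPolynomial.eval y p) + fun y => MvPolynomial.eval y q := by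
      funext y; simp
    rw [e]
    refine (hp.add hq).congr_fderiv ?_
    simp [add_smul, Finset.sum_add_distrib]
  | mul_X p j hp =>
    have hX : HasFDerivAt (fun y : ι → ℝ => y j)
        (ContinuousLinearMap.proj j : (ι → ℝ) →L[ℝ] ℝ) x := hasFDerivAt_apply j x
    have e : (fun y : ι → ℝ => MvPolynomial.eval y (p * MvPolynomial.X j)) =
        (fun y => MvPolynomial.eval y p) * fun y => y j := by
      funext y; simp
    rw [e]
    refine (hp.mul hX).congr_fderiv ?_
    ext v
    simp [MvPolynomial.pderiv_X, Pi.single_apply, add_mul, Finset.sum_add_distrib,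
      Finset.mul_sum, apply_ite]
    ring_nf

/-- Interpolation: polynomials of degree `< #S` separate the points of `S`. -/
lemma exists_mvPolynomial_eval_ne_zero {ι : Type*} (S : Finset (ι → ℝ)) {s : ι → ℝ} (hs : s ∈ S) :
    ∃ h : MvPolynomial ι ℝ, h.totalDegree ≤ S.card - 1 ∧ MvPolynomial.eval s h ≠ 0 ∧
      ∀ t ∈ S, t ≠ s → MvPolynomial.eval t h = 0 := by
  classical
  have key : ∀ t : ι → ℝ, ∃ q : MvPolynomial ι ℝ, q.totalDegree ≤ 1 ∧
      MvPolynomial.eval s q ≠ 0 ∧ (t ≠ s → MvPolynomial.eval t q = 0) := fun t => by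
    by_cases hts : t = s
    · exact ⟨1, by simp, by simp, fun h => absurd hts h⟩
    · obtain ⟨j, hj⟩ := Function.ne_iff.mp hts
      refine ⟨MvPolynomial.X j - MvPolynomial.C (t j),
        (MvPolynomial.totalDegree_sub_C_le _ _).trans (by simp), ?_, fun _ => by simp⟩
      simpa [sub_eq_zero] using hj.symm
  choose q hq1 hq2 hq3 using key
  refine ⟨∏ t ∈ S.erase s, q t, ?_, ?_, ?_⟩
  · refine (MvPolynomial.totalDegree_finsetProd _ _).trans ?_
    rw [← Finset.card_erase_of_mem hs, Finset.card_eq_sum_ones]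
    exact Finset.sum_le_sum fun t _ => hq1 t
  · rw [map_prod, Finset.prod_ne_zero_iff]
    exact fun t _ => hq2 t
  · intro t ht hts
    rw [map_prod]
    exact Finset.prod_eq_zero (Finset.mem_erase.mpr ⟨hts, ht⟩) (hq3 t hts)

lemma card_le_of_linearIndependent_of_totalDegree_le {ι κ : Type*} [Fintype ι] [Fintype κ] {N : ℕ}
    {e : κ → MvPolynomial ι ℝ} (he : LinearIndependent ℝ e) (hN : ∀ k, (e k).totalDegree ≤ N) :
    Fintype.card κ ≤ (N + 1) ^ Fintype.card ι := by
  classical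
  let L : MvPolynomial ι ℝ →ₗ[ℝ] ((ι → Fin (N + 1)) → ℝ) :=
    LinearMap.pi fun a => MvPolynomial.lcoeff ℝ (Finsupp.equivFunOnFinite.symm fun i => (a i : ℕ))
  have hL : LinearIndependent ℝ (fun k => L (e k)) := by
    rw [Fintype.linearIndependent_iff] at he ⊢
    intro c hc
    refine he c ?_
    have h0 : L (∑ k, c k • e k) = 0 := by simpa using hc
    have hdeg : (∑ k, c k • e k).totalDegree ≤ N :=
      MvPolynomial.totalDegree_finsetSum_le fun k _ =>
        (MvPolynomial.totalDegree_smul_le _ _).trans (hN k)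
    generalize ∑ k, c k • e k = P at h0 hdeg
    ext m
    by_cases hm : ∀ i, m i ≤ N
    · have := congrFun h0 fun i => ⟨m i, Nat.lt_succ_of_le (hm i)⟩
      have hm' : (Finsupp.equivFunOnFinite.symm fun i => m i) = m := by ext; simp
      simpa [L, hm'] using this
    · push Not at hm
      obtain ⟨i, hi⟩ := hm
      rw [MvPolynomial.coeff_eq_zero_of_totalDegree_lt]
      · simp
      · refine lt_of_le_of_lt hdeg (hi.trans_le ?_)
        by_cases him : i ∈ m.support
        · exact Finset.single_le_sum (f := fun i => m i) (fun _ _ => Nat.zero_le _) him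
        · simp [Finsupp.notMem_support_iff.mp him] at hi
  have := hL.fintype_card_le_finrank
  simpa using this

open Filter Topology in
/-- Along a line through a zero `t` of `P`, the quotient `P (t + τ v) / τ` tends to the directional
derivative. -/
lemma tendsto_inv_mul_eval_line {ι : Type*} [Fintype ι] (P : MvPolynomial ι ℝ) {t : ι → ℝ}
    (ht : MvPolynomial.eval t P = 0) (v : ι → ℝ) :
    Tendsto (fun τ : ℝ => τ⁻¹ * MvPolynomial.eval (t + τ • v) P) (𝓝[≠] 0)
      (𝓝 (∑ j, MvPolynomial.eval t (MvPolynomial.pderiv j P) * v j)) := by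
  have hline : HasDerivAt (fun τ : ℝ => t + τ • v) v 0 := by
    simpa using ((hasDerivAt_id (0 : ℝ)).smul_const v).const_add t
  have h0 : HasFDerivAt (fun y : ι → ℝ => MvPolynomial.eval y P)
      (∑ i, MvPolynomial.eval t (MvPolynomial.pderiv i P) •
        (ContinuousLinearMap.proj i : (ι → ℝ) →L[ℝ] ℝ)) ((fun τ : ℝ => t + τ • v) 0) := by
    simpa using hasFDerivAt_eval_mvPolynomial P t
  have h := (h0.comp_hasDerivAt (0 : ℝ) hline).tendsto_slope_zero
  simpa [ht] using h

open Filter Topology in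
lemma linearIndependent_interpolation_mul_prod_pow {ι κ : Type*} [Fintype ι] [DecidableEq ι]
    (g : ι → MvPolynomial ι ℝ) (S : Finset (ι → ℝ))
    (hz : ∀ s ∈ S, ∀ i, MvPolynomial.eval s (g i) = 0)
    (hJ : ∀ s ∈ S, (Matrix.of fun i j =>
      MvPolynomial.eval s (MvPolynomial.pderiv j (g i))).det ≠ 0)
    (h : S → MvPolynomial ι ℝ) (hne : ∀ s : S, MvPolynomial.eval s.1 (h s) ≠ 0)
    (hzero : ∀ s t : S, t ≠ s → MvPolynomial.eval t.1 (h s) = 0)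
    [Fintype κ] (a : κ → ι →₀ ℕ) (ha : Function.Injective a) :
    LinearIndependent ℝ fun k : S × κ => h k.1 * ∏ i, g i ^ a k.2 i := by
  classical
  rw [Fintype.linearIndependent_iff]
  intro c hc
  by_contra! hcon
  set w : κ → ℕ := fun k => ∑ i, a k i with hw
  obtain ⟨k0, hk0, hmin⟩ := Finset.exists_min_image
    (Finset.univ.filter fun k : S × κ => c k ≠ 0) (fun k => w k.2)
    (by obtain ⟨k, hk⟩ := hcon; exact ⟨k, by simpa using hk⟩)
  obtain ⟨t, b⟩ := k0
  have hcb : c (t, b) ≠ 0 := by simpa using hk0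
  have hlow : ∀ k : S × κ, c k = 0 ∨ w b ≤ w k.2 := fun k => by
    by_cases hk : c k = 0
    · exact Or.inl hk
    · exact Or.inr (hmin k (by simpa using hk))
  set J : Matrix ι ι ℝ := Matrix.of fun i j =>
      MvPolynomial.eval t.1 (MvPolynomial.pderiv j (g i)) with hJdef
  have hlim : ∀ v : ι → ℝ, ∑ k : S × κ, c k * (MvPolynomial.eval t.1 (h k.1) *
      (0 ^ (w k.2 - w b) * ∏ i, (J *ᵥ v) i ^ a k.2 i)) = 0 := by
    intro v
    have hT : Tendsto (fun τ : ℝ => ∑ k : S × κ, c k * (MvPolynomial.eval (t.1 + τ • v) (h k.1) *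
        (τ ^ (w k.2 - w b) * ∏ i, (τ⁻¹ * MvPolynomial.eval (t.1 + τ • v) (g i)) ^ a k.2 i)))
        (𝓝[≠] 0) (𝓝 (∑ k : S × κ, c k * (MvPolynomial.eval t.1 (h k.1) *
          (0 ^ (w k.2 - w b) * ∏ i, (J *ᵥ v) i ^ a k.2 i)))) := by
      refine tendsto_finsetSum _ fun k _ => tendsto_const_nhds.mul (Tendsto.mul ?_ (Tendsto.mul ?_
        (tendsto_finsetProd _ fun i _ => Tendsto.pow ?_ _)))
      · have hcont : Continuous fun τ : ℝ => MvPolynomial.eval (t.1 + τ • v) (h k.1) :=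
          (MvPolynomial.continuous_eval _).comp (by fun_prop)
        have := hcont.tendsto 0
        simp only [zero_smul, add_zero] at this
        exact this.mono_left nhdsWithin_le_nhds
      · have hcont : Continuous fun τ : ℝ => τ ^ (w k.2 - w b) := by fun_prop
        exact (hcont.tendsto 0).mono_left nhdsWithin_le_nhds
      · exact tendsto_inv_mul_eval_line (g i) (hz t.1 t.2 i) v
    have hev : (fun τ : ℝ => ∑ k : S × κ, c k * (MvPolynomial.eval (t.1 + τ • v) (h k.1) *
        (τ ^ (w k.2 - w b) * ∏ i, (τ⁻¹ * MvPolynomial.eval (t.1 + τ • v) (g i)) ^ a k.2 i)))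
        =ᶠ[𝓝[≠] 0] fun _ => 0 := by
      filter_upwards [self_mem_nhdsWithin] with τ hτ
      have hτ' : τ ≠ 0 := hτ
      have h1 : ∀ k : S × κ, τ ^ w b * (c k * (MvPolynomial.eval (t.1 + τ • v) (h k.1) *
          (τ ^ (w k.2 - w b) * ∏ i, (τ⁻¹ * MvPolynomial.eval (t.1 + τ • v) (g i)) ^ a k.2 i))) =
          MvPolynomial.eval (t.1 + τ • v) (c k • (h k.1 * ∏ i, g i ^ a k.2 i)) := by
        intro k
        rcases hlow k with hk | hk
        · simp [hk]
        · have h2 : τ ^ w b * τ ^ (w k.2 - w b) * (∏ i, τ⁻¹ ^ a k.2 i) = 1 := by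
            rw [← pow_add, Nat.add_sub_cancel' hk, Finset.prod_pow_eq_pow_sum, inv_pow]
            exact mul_inv_cancel₀ (pow_ne_zero _ hτ')
          simp only [mul_pow, Finset.prod_mul_distrib, MvPolynomial.smul_eval, map_mul, map_prod,
            map_pow]
          linear_combination (c k * MvPolynomial.eval (t.1 + τ • v) (h k.1) *
            ∏ i, MvPolynomial.eval (t.1 + τ • v) (g i) ^ a k.2 i) * h2
      have h3 := congrArg (MvPolynomial.eval (t.1 + τ • v)) hc
      rw [map_sum, map_zero, ← Finset.sum_congr rfl fun k _ => h1 k, ← Finset.mul_sum] at h3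
      exact (mul_eq_zero.mp h3).resolve_left (pow_ne_zero _ hτ')
    exact tendsto_nhds_unique (hT.congr' hev) tendsto_const_nhds |>.symm ▸ rfl
  have hQ : ∑ k : S × κ, MvPolynomial.monomial (a k.2)
      (c k * MvPolynomial.eval t.1 (h k.1) * 0 ^ (w k.2 - w b)) = 0 := by
    refine MvPolynomial.funext fun y => ?_
    have hunit : IsUnit J.det := isUnit_iff_ne_zero.mpr (hJ t.1 t.2)
    have := hlim (J⁻¹ *ᵥ y)
    rw [Matrix.mulVec_mulVec, Matrix.mul_nonsing_inv _ hunit, Matrix.one_mulVec] at this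
    rw [map_sum, map_zero]
    refine Eq.trans (Finset.sum_congr rfl fun k _ => ?_) this
    rw [MvPolynomial.eval_monomial, Finsupp.prod_fintype _ _ (by simp)]
    ring
  have hcoef := congrArg (MvPolynomial.coeff (a b)) hQ
  rw [MvPolynomial.coeff_sum, MvPolynomial.coeff_zero,
    Finset.sum_eq_single_of_mem (t, b) (Finset.mem_univ _)] at hcoef
  · simp [hcb, hne t] at hcoef
  · rintro ⟨s, b'⟩ - hsb
    rw [MvPolynomial.coeff_monomial]
    split_ifs with hab
    · obtain rfl := ha hab
      have hts : t ≠ s := by rintro rfl; exact hsb rfl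
      simp [hzero s t hts]
    · rfl

/-- A weak Bézout bound for the nondegenerate real zeros of a square system. -/
lemma card_nondegenerate_zeros_le {ι : Type*} [Fintype ι] [DecidableEq ι]
    (g : ι → MvPolynomial ι ℝ) {Δ : ℕ} (hg : ∀ i, (g i).totalDegree ≤ Δ) (S : Finset (ι → ℝ))
    (hz : ∀ s ∈ S, ∀ i, MvPolynomial.eval s (g i) = 0)
    (hJ : ∀ s ∈ S, (Matrix.of fun i j =>
      MvPolynomial.eval s (MvPolynomial.pderiv j (g i))).det ≠ 0) :
    S.card ≤ (1 + Fintype.card ι * Δ) ^ Fintype.card ι := by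
  classical
  rcases S.eq_empty_or_nonempty with rfl | hS
  · simp
  choose h hdeg hne hzero using fun s : S => exists_mvPolynomial_eval_ne_zero S s.2
  set M := S.card with hM
  have hMpos : 0 < M := hS.card_pos
  have hli := linearIndependent_interpolation_mul_prod_pow g S hz hJ h hne
    (fun s t hts => hzero s t.1 t.2 fun e => hts (Subtype.ext e))
    (κ := ι → Fin (M + 1))
    (fun b => Finsupp.equivFunOnFinite.symm fun i => (b i : ℕ))
    (fun b b' e => by
      funext i
      have := DFunLike.congr_fun e i
      exact Fin.ext (by simpa using this))
  have hcard := card_le_of_linearIndependent_of_totalDegree_le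
    (N := (M - 1) + Fintype.card ι * (M * Δ)) hli (fun k => by
      refine (MvPolynomial.totalDegree_mul _ _).trans (Nat.add_le_add (hdeg _) ?_)
      refine (MvPolynomial.totalDegree_finsetProd _ _).trans ?_
      rw [← smul_eq_mul, ← Finset.card_univ, ← Finset.sum_const]
      refine Finset.sum_le_sum fun i _ => (MvPolynomial.totalDegree_pow _ _).trans ?_
      exact Nat.mul_le_mul (by simpa using Nat.lt_succ_iff.mp (k.2 i).2) (hg i))
  rw [show M - 1 + Fintype.card ι * (M * Δ) + 1 = M * (1 + Fintype.card ι * Δ) by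
    rw [mul_add, mul_one, mul_left_comm]; omega] at hcard
  simp only [Fintype.card_prod, Fintype.card_coe, Fintype.card_fun, Fintype.card_fin] at hcard
  rw [← hM, mul_pow] at hcard
  have h1 : M ^ Fintype.card ι ≤ (M + 1) ^ Fintype.card ι := Nat.pow_le_pow_left (by omega) _
  have hpos : 0 < M ^ Fintype.card ι := by positivity
  refine Nat.le_of_mul_le_mul_right (c := M ^ Fintype.card ι) ?_ hpos
  calc M * M ^ Fintype.card ι ≤ M * (M + 1) ^ Fintype.card ι := Nat.mul_le_mul_left _ h1
    _ ≤ _ := hcard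
    _ = _ := mul_comm _ _

lemma totalDegree_pderiv_le {ι R : Type*} [CommSemiring R] (i : ι) (P : MvPolynomial ι R) :
    (MvPolynomial.pderiv i P).totalDegree ≤ P.totalDegree := by
  refine Finset.sup_le fun m hm => ?_
  rw [MvPolynomial.mem_support_iff, MvPolynomial.coeff_pderiv] at hm
  have h := MvPolynomial.le_totalDegree
    (MvPolynomial.mem_support_iff.mpr (left_ne_zero_of_mul hm))
  rw [Finsupp.sum_add_index' (by simp) (by simp)] at h
  exact le_trans (Nat.le_add_right _ _) h

/-- Sard theorem for a polynomial gradient: arbitrarily small shifts make all critical points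
nondegenerate. -/
lemma exists_small_regular_value {ι : Type*} [Fintype ι] [DecidableEq ι] (G : MvPolynomial ι ℝ)
    {δ : ℝ} (hδ : 0 < δ) :
    ∃ η : ι → ℝ, (∀ i, |η i| < δ) ∧ ∀ x : ι → ℝ,
      (∀ i, MvPolynomial.eval x (MvPolynomial.pderiv i G) = η i) →
      (Matrix.of fun i j => MvPolynomial.eval x
        (MvPolynomial.pderiv j (MvPolynomial.pderiv i G))).det ≠ 0 := by
  set H : (ι → ℝ) → Matrix ι ι ℝ := fun x => Matrix.of fun i j => MvPolynomial.eval x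
        (MvPolynomial.pderiv j (MvPolynomial.pderiv i G)) with hH
  set f : (ι → ℝ) → (ι → ℝ) := fun x i => MvPolynomial.eval x (MvPolynomial.pderiv i G) with hf
  have hderiv : ∀ x, HasFDerivAt f (LinearMap.toContinuousLinearMap (Matrix.toLin' (H x))) x := by
    intro x
    rw [hasFDerivAt_pi']
    intro i
    refine (hasFDerivAt_eval_mvPolynomial (MvPolynomial.pderiv i G) x).congr_fderiv ?_
    ext v
    simp [hH, Matrix.mulVec, dotProduct]
  have hnull := addHaar_image_eq_zero_of_det_fderivWithin_eq_zero (volume : Measure (ι → ℝ))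
    (s := {x | (H x).det = 0}) (fun x _ => (hderiv x).hasFDerivWithinAt) (fun x hx => by
      rw [ContinuousLinearMap.det, LinearMap.coe_toContinuousLinearMap, LinearMap.det_toLin']
      exact hx)
  have hball : 0 < (volume : Measure (ι → ℝ)) (Metric.ball 0 δ) := Metric.measure_ball_pos _ _ hδ
  obtain ⟨η, hη, hη'⟩ : ∃ η ∈ Metric.ball (0 : ι → ℝ) δ, η ∉ f '' {x | (H x).det = 0} := by
    by_contra! hcon
    exact hball.ne' (measure_mono_null (fun y hy => hcon y hy) hnull)
  refine ⟨η, fun i => ?_, fun x hx hdet => hη' ⟨x, hdet, funext hx⟩⟩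
  rw [mem_ball_zero_iff] at hη
  exact (norm_le_pi_norm η i).trans_lt hη

open Filter Topology in
/-- A Warren-type bound: points off the zero set of `F` that are pairwise separated by the signs of
continuous functions whose zeros are zeros of `F`. -/
lemma card_le_of_sign_separated {ι J : Type*} [Fintype ι] [Finite J] (F : MvPolynomial ι ℝ) {Δ : ℕ}
    (hF : F.totalDegree ≤ Δ) (g : J → (ι → ℝ) → ℝ) (hg : ∀ j, Continuous (g j))
    (hgF : ∀ j x, g j x = 0 → MvPolynomial.eval x F = 0) (S : Finset (ι → ℝ))
    (hS : ∀ x ∈ S, MvPolynomial.eval x F ≠ 0)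
    (hsep : ∀ x ∈ S, ∀ y ∈ S, x ≠ y → ∃ j, g j x * g j y < 0) :
    S.card ≤ (1 + Fintype.card ι * (2 * Δ + 2)) ^ Fintype.card ι := by
  classical
  rcases S.eq_empty_or_nonempty with rfl | hSne
  · simp
  obtain ⟨R, hR⟩ : ∃ R : ℝ, ∀ x ∈ S, ∑ i, x i ^ 2 < R := by
    obtain ⟨y, hy, hmax⟩ := S.exists_max_image (fun x => ∑ i, x i ^ 2) hSne
    exact ⟨(∑ i, y i ^ 2) + 1, fun x hx => lt_of_le_of_lt (hmax x hx) (lt_add_one _)⟩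
  have hRpos : 0 < R := by
    obtain ⟨y, hy⟩ := hSne
    exact lt_of_le_of_lt (Finset.sum_nonneg fun i _ => sq_nonneg (y i)) (hR y hy)
  set G : MvPolynomial ι ℝ := F ^ 2 * (MvPolynomial.C R - ∑ i, MvPolynomial.X i ^ 2) with hGdef
  have hGeval : ∀ x, MvPolynomial.eval x G = MvPolynomial.eval x F ^ 2 * (R - ∑ i, x i ^ 2) := by
    intro x; simp [hGdef]
  have hGdeg : G.totalDegree ≤ 2 * Δ + 2 := by
    refine (MvPolynomial.totalDegree_mul _ _).trans (Nat.add_le_add ?_ ?_)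
    · exact (MvPolynomial.totalDegree_pow _ _).trans (Nat.mul_le_mul_left _ hF)
    · refine (MvPolynomial.totalDegree_sub _ _).trans (max_le (by simp) ?_)
      exact MvPolynomial.totalDegree_finsetSum_le fun i _ => by
        rw [MvPolynomial.totalDegree_X_pow]
  obtain ⟨y0, hy0, hmin⟩ := S.exists_min_image (fun x => MvPolynomial.eval x G) hSne
  set μ := MvPolynomial.eval y0 G with hμ
  have hGpos : ∀ x ∈ S, 0 < MvPolynomial.eval x G := fun x hx => by
    rw [hGeval]
    have := hS x hx
    have := hR x hx
    exact mul_pos (by positivity) (by linarith)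
  have hμpos : 0 < μ := hGpos y0 hy0
  set K := Real.sqrt R with hK
  have hcoord : ∀ z : ι → ℝ, ∑ i, z i ^ 2 ≤ R → ∀ i, |z i| ≤ K := fun z hz i =>
    Real.abs_le_sqrt ((Finset.single_le_sum (f := fun i => z i ^ 2)
      (fun i _ => sq_nonneg (z i)) (Finset.mem_univ i)).trans hz)
  have hKpos : 0 < K := Real.sqrt_pos.mpr hRpos
  obtain ⟨η, hηsmall, hηreg⟩ := exists_small_regular_value G
    (δ := μ / (2 * (Fintype.card ι + 1) * K)) (by positivity)
  have hlin : ∀ z : ι → ℝ, ∑ i, z i ^ 2 ≤ R → |∑ i, η i * z i| < μ / 2 := by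
    intro z hz
    calc |∑ i, η i * z i| ≤ ∑ i, |η i * z i| := Finset.abs_sum_le_sum_abs _ _
      _ ≤ ∑ _i : ι, μ / (2 * (Fintype.card ι + 1) * K) * K := by
        refine Finset.sum_le_sum fun i _ => ?_
        rw [abs_mul]
        exact mul_le_mul (hηsmall i).le (hcoord z hz i) (abs_nonneg _) (by positivity)
      _ = μ / 2 * (Fintype.card ι / (Fintype.card ι + 1)) := by
        rw [Finset.sum_const, Finset.card_univ, nsmul_eq_mul]
        field_simp
      _ < μ / 2 * 1 := by
        refine mul_lt_mul_of_pos_left ?_ (by positivity)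
        rw [div_lt_one (by positivity)]
        exact lt_add_one _
      _ = μ / 2 := mul_one _
  have hcrit : ∀ x : S, ∃ z : ι → ℝ,
      (∀ i, MvPolynomial.eval z (MvPolynomial.pderiv i G) = η i) ∧ ∀ j, 0 < g j z * g j x := by
    rintro ⟨x, hx⟩
    set T : Set (ι → ℝ) := {z | ∑ i, z i ^ 2 ≤ R ∧ ∀ j, 0 ≤ g j z * g j x} with hT
    have hTclosed : IsClosed T := by
      rw [hT, Set.ofPred_and, Set.ofPred_forall]
      exact (isClosed_le (by fun_prop) continuous_const).inter
        (isClosed_iInter fun j => isClosed_le continuous_const ((hg j).mul continuous_const))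
    have hTcompact : IsCompact T := by
      refine Metric.isCompact_of_isClosed_isBounded hTclosed ?_
      refine (Metric.isBounded_closedBall (x := (0 : ι → ℝ)) (r := K)).subset fun z hz => ?_
      rw [mem_closedBall_zero_iff, pi_norm_le_iff_of_nonneg hKpos.le]
      exact hcoord z hz.1
    have hxT : x ∈ T := ⟨(hR x hx).le, fun j => mul_self_nonneg _⟩
    have hφ : Continuous fun z : ι → ℝ => MvPolynomial.eval z G - ∑ i, η i * z i :=
      (MvPolynomial.continuous_eval G).sub (by fun_prop)
    obtain ⟨z, hzT, hzmax⟩ := hTcompact.exists_isMaxOn ⟨x, hxT⟩ hφ.continuousOn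
    have hGz : 0 < MvPolynomial.eval z G := by
      have h1 := hzmax hxT
      simp only [Set.mem_ofPred_eq] at h1
      have h2 := abs_lt.mp (hlin z hzT.1)
      have h3 := abs_lt.mp (hlin x (hR x hx).le)
      have h4 := hmin x hx
      linarith
    rw [hGeval] at hGz
    have hFz : MvPolynomial.eval z F ≠ 0 := fun h => by simp [h] at hGz
    have hzR : ∑ i, z i ^ 2 < R := by
      have : 0 < MvPolynomial.eval z F ^ 2 := by positivity
      linarith [(mul_pos_iff_of_pos_left this).mp hGz]
    have hgz : ∀ j, 0 < g j z * g j x := fun j =>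
      lt_of_le_of_ne (hzT.2 j) (mul_ne_zero (fun h => hFz (hgF j z h))
        (fun h => hS x hx (hgF j x h))).symm
    have hnhds : T ∈ 𝓝 z := by
      have ho : IsOpen {z : ι → ℝ | ∑ i, z i ^ 2 < R ∧ ∀ j, 0 < g j z * g j x} := by
        rw [Set.ofPred_and, Set.ofPred_forall]
        exact (isOpen_lt (by fun_prop) continuous_const).inter
          (isOpen_iInter_of_finite fun j =>
            isOpen_lt continuous_const ((hg j).mul continuous_const))
      exact Filter.mem_of_superset (ho.mem_nhds ⟨hzR, hgz⟩) fun y hy =>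
        ⟨hy.1.le, fun j => (hy.2 j).le⟩
    have hloc := hzmax.isLocalMax hnhds
    have hder := hloc.hasFDerivAt_eq_zero ((hasFDerivAt_eval_mvPolynomial G z).sub
      (HasFDerivAt.fun_sum fun i _ => (hasFDerivAt_apply i z).const_mul (η i)))
    refine ⟨z, fun i => ?_, hgz⟩
    have := DFunLike.congr_fun hder (Pi.single i (1 : ℝ))
    simpa [Pi.single_apply, sub_eq_zero] using this
  choose z hz1 hz2 using hcrit
  have hinj : Function.Injective z := by
    intro x y hxy
    by_contra hne
    obtain ⟨j, hj⟩ := hsep x x.2 y y.2 fun h => hne (Subtype.ext h)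
    have h1 := hz2 x j
    have h2 := hz2 y j
    rw [← hxy] at h2
    have h3 : 0 < g j (z x) ^ 2 * (g j x * g j y) := by nlinarith [mul_pos h1 h2]
    nlinarith [sq_nonneg (g j (z x))]
  have := card_nondegenerate_zeros_le (fun i => MvPolynomial.pderiv i G - MvPolynomial.C (η i))
    (Δ := 2 * Δ + 2) (fun i => (MvPolynomial.totalDegree_sub_C_le _ _).trans
      ((totalDegree_pderiv_le i G).trans hGdeg))
    (Finset.univ.image z) ?_ ?_
  · rwa [Finset.card_image_of_injective _ hinj, Finset.card_univ, Fintype.card_coe] at this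
  · intro s hs i
    obtain ⟨x, -, rfl⟩ := Finset.mem_image.mp hs
    simp [hz1 x i]
  · intro s hs
    obtain ⟨x, -, rfl⟩ := Finset.mem_image.mp hs
    simpa using hηreg (z x) (hz1 x)

lemma rayleigh_eq_dotProduct {m : ℕ} (A : Matrix (Fin m) (Fin m) ℝ) (v : Fin m → ℝ) :
    rayleigh A v = v ⬝ᵥ (A *ᵥ v) := by
  simp [rayleigh, dotProduct, Matrix.mulVec, Finset.mul_sum, mul_assoc]

lemma sum_sq_eq_dotProduct {m : ℕ} (v : Fin m → ℝ) : ∑ i, v i ^ 2 = v ⬝ᵥ v := by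
  simp [dotProduct, sq]

lemma rayleigh_add {m : ℕ} (A B : Matrix (Fin m) (Fin m) ℝ) (v : Fin m → ℝ) :
    rayleigh (A + B) v = rayleigh A v + rayleigh B v := by
  simp [rayleigh_eq_dotProduct, Matrix.add_mulVec]

lemma rayleigh_smul {m : ℕ} (c : ℝ) (A : Matrix (Fin m) (Fin m) ℝ) (v : Fin m → ℝ) :
    rayleigh (c • A) v = c * rayleigh A v := by
  simp [rayleigh_eq_dotProduct, Matrix.smul_mulVec]

lemma rayleigh_sub_smul_one {m : ℕ} (A : Matrix (Fin m) (Fin m) ℝ) (c : ℝ) (v : Fin m → ℝ) :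
    rayleigh (A - c • 1) v = rayleigh A v - c * ∑ i, v i ^ 2 := by
  simp [rayleigh_eq_dotProduct, Matrix.sub_mulVec, Matrix.smul_mulVec, sum_sq_eq_dotProduct]

lemma abs_le_one_of_sum_sq_eq_one {ι : Type*} [Fintype ι] {v : ι → ℝ} (hv : ∑ i, v i ^ 2 = 1)
    (i : ι) : |v i| ≤ 1 := by
  refine (sq_le_one_iff_abs_le_one _).mp (hv ▸ ?_)
  exact Finset.single_le_sum (f := fun i => v i ^ 2) (fun i _ => sq_nonneg (v i))
    (Finset.mem_univ i)

lemma isCompact_setOf_sum_sq_eq_one (ι : Type*) [Fintype ι] :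
    IsCompact {v : ι → ℝ | ∑ i, v i ^ 2 = 1} := by
  refine Metric.isCompact_of_isClosed_isBounded
    (isClosed_eq (by fun_prop) continuous_const) ?_
  refine (Metric.isBounded_closedBall (x := (0 : ι → ℝ)) (r := 1)).subset fun v hv => ?_
  rw [mem_closedBall_zero_iff, pi_norm_le_iff_of_nonneg zero_le_one]
  exact abs_le_one_of_sum_sq_eq_one hv

lemma continuous_rayleigh {m : ℕ} (A : Matrix (Fin m) (Fin m) ℝ) : Continuous (rayleigh A) := by
  unfold rayleigh
  fun_prop

lemma bddAbove_rayleigh {m : ℕ} (A : Matrix (Fin m) (Fin m) ℝ) :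
    BddAbove (rayleigh A '' {v | ∑ i, v i ^ 2 = 1}) :=
  (isCompact_setOf_sum_sq_eq_one _).bddAbove_image (continuous_rayleigh A).continuousOn

lemma lambdaMax_eq_sSup_image {m : ℕ} (A : Matrix (Fin m) (Fin m) ℝ) :
    lambdaMax A = sSup (rayleigh A '' {v | ∑ i, v i ^ 2 = 1}) := by
  unfold lambdaMax
  congr 1
  ext r
  simp [eq_comm]

lemma rayleigh_le_lambdaMax {m : ℕ} (A : Matrix (Fin m) (Fin m) ℝ) {v : Fin m → ℝ}
    (hv : ∑ i, v i ^ 2 = 1) : rayleigh A v ≤ lambdaMax A := by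
  rw [lambdaMax_eq_sSup_image]
  exact le_csSup (bddAbove_rayleigh A) ⟨v, hv, rfl⟩

lemma exists_rayleigh_eq_lambdaMax {m : ℕ} (hm : 0 < m) (A : Matrix (Fin m) (Fin m) ℝ) :
    ∃ v : Fin m → ℝ, ∑ i, v i ^ 2 = 1 ∧ rayleigh A v = lambdaMax A := by
  have hne : {v : Fin m → ℝ | ∑ i, v i ^ 2 = 1}.Nonempty :=
    ⟨Pi.single ⟨0, hm⟩ 1, by simp [Pi.single_apply]⟩
  obtain ⟨v, hv, hmax⟩ := (isCompact_setOf_sum_sq_eq_one (Fin m)).exists_sSup_image_eq hne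
    (continuous_rayleigh A).continuousOn
  exact ⟨v, hv, by rw [lambdaMax_eq_sSup_image, hmax]⟩

lemma lambdaMax_le {m : ℕ} (hm : 0 < m) {A : Matrix (Fin m) (Fin m) ℝ} {r : ℝ}
    (h : ∀ v : Fin m → ℝ, ∑ i, v i ^ 2 = 1 → rayleigh A v ≤ r) : lambdaMax A ≤ r := by
  obtain ⟨v, hv, he⟩ := exists_rayleigh_eq_lambdaMax hm A
  exact he ▸ h v hv

lemma rayleigh_smul_vec {m : ℕ} (A : Matrix (Fin m) (Fin m) ℝ) (c : ℝ) (v : Fin m → ℝ) :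
    rayleigh A (c • v) = c ^ 2 * rayleigh A v := by
  simp [rayleigh_eq_dotProduct, Matrix.mulVec_smul]
  ring

lemma rayleigh_le_lambdaMax_mul {m : ℕ} (A : Matrix (Fin m) (Fin m) ℝ) (v : Fin m → ℝ) :
    rayleigh A v ≤ lambdaMax A * ∑ i, v i ^ 2 := by
  rcases (Finset.sum_nonneg fun i _ => sq_nonneg (v i) : 0 ≤ ∑ i, v i ^ 2).eq_or_lt with h | h
  · have hv : v = 0 := by
      funext i
      simpa using (Finset.sum_eq_zero_iff_of_nonneg fun i _ => sq_nonneg (v i)).mp h.symm i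
        (Finset.mem_univ i)
    simp [hv, rayleigh]
  · set N := ∑ i, v i ^ 2 with hN
    have h1 := rayleigh_le_lambdaMax A (v := (√N)⁻¹ • v) (by
      simp only [Pi.smul_apply, smul_eq_mul, mul_pow, ← Finset.mul_sum, inv_pow, Real.sq_sqrt h.le]
      exact inv_mul_cancel₀ h.ne')
    rw [rayleigh_smul_vec, inv_pow, Real.sq_sqrt h.le, inv_mul_le_iff₀ h] at h1
    linarith

lemma lambdaMax_smul {m : ℕ} (hm : 0 < m) {c : ℝ} (hc : 0 ≤ c) (A : Matrix (Fin m) (Fin m) ℝ) :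
    lambdaMax (c • A) = c * lambdaMax A := by
  refine le_antisymm (lambdaMax_le hm fun v hv => ?_) ?_
  · rw [rayleigh_smul]
    exact mul_le_mul_of_nonneg_left (rayleigh_le_lambdaMax A hv) hc
  · obtain ⟨v, hv, he⟩ := exists_rayleigh_eq_lambdaMax hm A
    rw [← he, ← rayleigh_smul]
    exact rayleigh_le_lambdaMax _ hv

lemma lambdaMax_sub_smul_one {m : ℕ} (hm : 0 < m) (A : Matrix (Fin m) (Fin m) ℝ) (c : ℝ) :
    lambdaMax (A - c • 1) = lambdaMax A - c := by
  refine le_antisymm (lambdaMax_le hm fun v hv => ?_) ?_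
  · rw [rayleigh_sub_smul_one, hv, mul_one]
    exact sub_le_sub_right (rayleigh_le_lambdaMax A hv) c
  · obtain ⟨v, hv, he⟩ := exists_rayleigh_eq_lambdaMax hm A
    have := rayleigh_le_lambdaMax (A - c • 1) hv
    rwa [rayleigh_sub_smul_one, hv, mul_one, he] at this

lemma lambdaMax_le_add_sum_abs {m : ℕ} (hm : 0 < m) (A B : Matrix (Fin m) (Fin m) ℝ) :
    lambdaMax A ≤ lambdaMax B + ∑ i, ∑ j, |A i j - B i j| := by
  refine lambdaMax_le hm fun v hv => ?_
  have h1 : rayleigh A v - rayleigh B v ≤ ∑ i, ∑ j, |A i j - B i j| := by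
    unfold rayleigh
    simp only [← Finset.sum_sub_distrib]
    refine Finset.sum_le_sum fun i _ => Finset.sum_le_sum fun j _ => ?_
    calc v i * A i j * v j - v i * B i j * v j = v i * v j * (A i j - B i j) := by ring
      _ ≤ |v i * v j * (A i j - B i j)| := le_abs_self _
      _ = |v i| * |v j| * |A i j - B i j| := by rw [abs_mul, abs_mul]
      _ ≤ 1 * 1 * |A i j - B i j| := by
        gcongr
        · exact abs_le_one_of_sum_sq_eq_one hv i
        · exact abs_le_one_of_sum_sq_eq_one hv j
      _ = _ := by ring
  linarith [rayleigh_le_lambdaMax B hv]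

lemma continuous_lambdaMax {m : ℕ} (hm : 0 < m) :
    Continuous (lambdaMax : Matrix (Fin m) (Fin m) ℝ → ℝ) := by
  rw [continuous_iff_continuousAt]
  intro A
  have hc : Continuous fun B : Matrix (Fin m) (Fin m) ℝ => ∑ i, ∑ j, |B i j - A i j| := by
    refine continuous_finsetSum _ fun i _ => continuous_finsetSum _ fun j _ => ?_
    exact ((continuous_apply_apply i j).sub continuous_const).abs
  have h0 := hc.tendsto A
  simp only [sub_self, abs_zero, Finset.sum_const_zero] at h0
  refine tendsto_iff_dist_tendsto_zero.mpr (squeeze_zero (fun _ => dist_nonneg) (fun B => ?_) h0)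
  rw [Real.dist_eq, abs_le]
  have h1 := lambdaMax_le_add_sum_abs hm A B
  have h2 := lambdaMax_le_add_sum_abs hm B A
  simp only [abs_sub_comm (A _ _)] at h1
  constructor <;> linarith

lemma mulVec_eq_of_rayleigh_eq_lambdaMax {m : ℕ} {A : Matrix (Fin m) (Fin m) ℝ} {v : Fin m → ℝ}
    (hv : ∑ i, v i ^ 2 = 1) (he : rayleigh A v = lambdaMax A) :
    (A + Aᵀ) *ᵥ v = (2 * lambdaMax A) • v := by
  set r : Fin m → ℝ := (A + Aᵀ) *ᵥ v - (2 * lambdaMax A) • v with hr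
  have key : ∀ s : ℝ, 0 ≤ s * (-(r ⬝ᵥ r)) + s ^ 2 * (lambdaMax A * (r ⬝ᵥ r) - rayleigh A r) := by
    intro s
    have h := rayleigh_le_lambdaMax_mul A (v + s • r)
    have h1 : r ⬝ᵥ (A *ᵥ v) + v ⬝ᵥ (A *ᵥ r) = r ⬝ᵥ r + 2 * lambdaMax A * (v ⬝ᵥ r) := by
      have : r ⬝ᵥ r = r ⬝ᵥ ((A + Aᵀ) *ᵥ v) - 2 * lambdaMax A * (v ⬝ᵥ r) := by
        conv_lhs => rw [hr, dotProduct_comm, sub_dotProduct, smul_dotProduct, smul_eq_mul,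
          dotProduct_comm]
      rw [this, Matrix.add_mulVec, dotProduct_add, Matrix.dotProduct_mulVec r Aᵀ v,
        Matrix.vecMul_transpose, dotProduct_comm v (A *ᵥ r)]
      ring
    rw [rayleigh_eq_dotProduct, sum_sq_eq_dotProduct] at h
    rw [rayleigh_eq_dotProduct] at he
    rw [sum_sq_eq_dotProduct] at hv
    rw [rayleigh_eq_dotProduct]
    simp only [Matrix.mulVec_add, Matrix.mulVec_smul, add_dotProduct, dotProduct_add,
      smul_dotProduct, dotProduct_smul, smul_eq_mul, hv, he, dotProduct_comm r v] at h
    linear_combination h - s * h1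
  have hrr : r ⬝ᵥ r = 0 := by
    by_contra hne
    have hpos : 0 < r ⬝ᵥ r := lt_of_le_of_ne (by
      rw [← sum_sq_eq_dotProduct]; exact Finset.sum_nonneg fun i _ => sq_nonneg _) (Ne.symm hne)
    set a := r ⬝ᵥ r
    set b := lambdaMax A * a - rayleigh A r
    have h1 := key (a / (2 * (|b| + 1)))
    have hb : b ≤ |b| := le_abs_self b
    have hb0 : 0 ≤ |b| := abs_nonneg b
    have h2 : a / (2 * (|b| + 1)) * (2 * (|b| + 1)) = a := by field_simp
    have hs : 0 < a / (2 * (|b| + 1)) := by positivity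
    set s := a / (2 * (|b| + 1))
    have h3 : 0 ≤ s * (-a + s * b) := by nlinarith
    have h4 : 0 ≤ -a + s * b := (mul_nonneg_iff_of_pos_left hs).mp h3
    nlinarith
  exact sub_eq_zero.mp (dotProduct_self_eq_zero.mp hrr)

/-- The matrix of the Sylvester operator `X ↦ M X - X Nᵀ`. -/
def sylvesterMatrix {R m : Type*} [CommRing R] [DecidableEq m] (M N : Matrix m m R) :
    Matrix (m × m) (m × m) R :=
  Matrix.of fun p q => M p.1 q.1 * (if p.2 = q.2 then 1 else 0) -
    (if p.1 = q.1 then 1 else 0) * N p.2 q.2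

lemma det_sylvesterMatrix_eq_zero {m : Type*} [Fintype m] [DecidableEq m]
    {M N : Matrix m m ℝ} {c : ℝ} {u v : m → ℝ} (hu : u ≠ 0) (hv : v ≠ 0)
    (hMu : M *ᵥ u = c • u) (hNv : N *ᵥ v = c • v) :
    (sylvesterMatrix M N).det = 0 := by
  rw [← Matrix.exists_mulVec_eq_zero_iff]
  refine ⟨fun p => u p.1 * v p.2, fun h => ?_, ?_⟩
  · obtain ⟨i, hi⟩ := Function.ne_iff.mp hu
    obtain ⟨j, hj⟩ := Function.ne_iff.mp hv
    exact mul_ne_zero hi hj (congrFun h (i, j))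
  · ext ⟨i, j⟩
    have h1 := congrFun hMu i
    have h2 := congrFun hNv j
    simp only [Matrix.mulVec, dotProduct, Pi.smul_apply, smul_eq_mul] at h1 h2
    simp only [Matrix.mulVec, dotProduct, sylvesterMatrix, Matrix.of_apply,
      Fintype.sum_prod_type, Pi.zero_apply, sub_mul, Finset.sum_sub_distrib]
    have e1 : ∑ x, ∑ y, M i x * (if j = y then 1 else 0) * (u x * v y) = c * u i * v j := by
      rw [← h1, Finset.sum_mul]
      refine Finset.sum_congr rfl fun x _ => ?_
      simp [mul_assoc]
    have e2 : ∑ x, ∑ y, (if i = x then 1 else 0) * N j y * (u x * v y) = u i * (c * v j) := by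
      rw [← h2, Finset.mul_sum]
      simp [mul_left_comm]
    rw [e1, e2]
    ring

lemma det_sylvesterMatrix_eq_zero_of_lambdaMax_eq {m : ℕ} (hm : 0 < m)
    {A B : Matrix (Fin m) (Fin m) ℝ} (h : lambdaMax A = lambdaMax B) :
    (sylvesterMatrix (A + Aᵀ) (B + Bᵀ)).det = 0 := by
  obtain ⟨u, hu, hu'⟩ := exists_rayleigh_eq_lambdaMax hm A
  obtain ⟨v, hv, hv'⟩ := exists_rayleigh_eq_lambdaMax hm B
  refine det_sylvesterMatrix_eq_zero (u := u) (v := v) ?_ ?_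
    (mulVec_eq_of_rayleigh_eq_lambdaMax hu hu') (h ▸ mulVec_eq_of_rayleigh_eq_lambdaMax hv hv')
  · rintro rfl; simp at hu
  · rintro rfl; simp at hv

lemma eventually_eval_smul_ne_zero {ι : Type*} {F : MvPolynomial ι ℝ}
    (hF : MvPolynomial.eval 0 F ≠ 0) (x : ι → ℝ) :
    ∀ᶠ r : ℝ in nhdsWithin 1 {1}ᶜ, MvPolynomial.eval (r • x) F ≠ 0 := by
  set p : Polynomial ℝ :=
    MvPolynomial.eval₂ Polynomial.C (fun i => Polynomial.C (x i) * Polynomial.X) F with hp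
  have hev : ∀ r : ℝ, p.eval r = MvPolynomial.eval (r • x) F := by
    intro r
    rw [hp, ← Polynomial.coe_evalRingHom, MvPolynomial.hom_eval₂]
    have h1 : (Polynomial.evalRingHom r).comp Polynomial.C = RingHom.id ℝ := by
      ext; simp
    have h2 : (fun i => (Polynomial.evalRingHom r) (Polynomial.C (x i) * Polynomial.X)) =
        r • x := by
      funext i; simp [mul_comm (x i)]
    rw [h1]
    exact congrArg (fun y => MvPolynomial.eval₂ (RingHom.id ℝ) y F) h2
  have hp0 : p ≠ 0 := fun h => hF (by simpa [h] using (hev 0).symm)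
  have hfin : {r : ℝ | p.IsRoot r}.Finite := Polynomial.finite_setOfPred_isRoot hp0
  have h1 := (hfin.subset (Set.sdiff_subset (t := {1}))).isClosed.isOpen_compl.mem_nhds
    (x := (1 : ℝ)) (by simp)
  filter_upwards [nhdsWithin_le_nhds h1, self_mem_nhdsWithin] with r hr hr1 h0
  exact hr ⟨by rw [Set.mem_ofPred_eq, Polynomial.IsRoot, hev, h0], hr1⟩

lemma card_le_of_sign_separated_family {ι J : Type*} [Fintype ι] [Fintype J]
    (p : J → MvPolynomial ι ℝ) {δ : ℕ} (hp : ∀ j, (p j).totalDegree ≤ δ)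
    (hp0 : ∀ j, MvPolynomial.eval 0 (p j) ≠ 0)
    (g : J → (ι → ℝ) → ℝ) (hg : ∀ j, Continuous (g j))
    (hgp : ∀ j x, g j x = 0 → MvPolynomial.eval x (p j) = 0)
    (S : Finset (ι → ℝ))
    (hsep : ∀ x ∈ S, ∀ y ∈ S, x ≠ y → ∃ j, g j x * g j y < 0) :
    S.card ≤ (1 + Fintype.card ι * (2 * (Fintype.card J * δ) + 2)) ^ Fintype.card ι := by
  classical
  set F := ∏ j, p j with hFdef
  have hF : F.totalDegree ≤ Fintype.card J * δ := by
    refine (MvPolynomial.totalDegree_finsetProd _ _).trans ?_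
    exact (Finset.sum_le_card_nsmul _ _ δ fun j _ => hp j).trans_eq (by simp)
  have hF0 : MvPolynomial.eval 0 F ≠ 0 := by
    rw [hFdef, map_prod]
    exact Finset.prod_ne_zero_iff.mpr fun j _ => hp0 j
  have hgF : ∀ j x, g j x = 0 → MvPolynomial.eval x F = 0 := by
    intro j x h
    rw [hFdef, map_prod]
    exact Finset.prod_eq_zero (Finset.mem_univ j) (hgp j x h)
  have e1 : ∀ᶠ r : ℝ in nhdsWithin 1 {1}ᶜ, ∀ x ∈ S, MvPolynomial.eval (r • x) F ≠ 0 :=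
    (Filter.eventually_all_finset S).mpr fun x _ => eventually_eval_smul_ne_zero hF0 x
  have e2 : ∀ᶠ r : ℝ in nhdsWithin 1 {1}ᶜ, ∀ x ∈ S, ∀ y ∈ S, x ≠ y →
      ∃ j, g j (r • x) * g j (r • y) < 0 := by
    refine (Filter.eventually_all_finset S).mpr fun x hx =>
      (Filter.eventually_all_finset S).mpr fun y hy => ?_
    by_cases hxy : x = y
    · exact Filter.Eventually.of_forall fun r h => absurd hxy h
    · obtain ⟨j, hj⟩ := hsep x hx y hy hxy
      have hc : Continuous fun r : ℝ => g j (r • x) * g j (r • y) := by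
        have := hg j
        fun_prop
      have := (hc.tendsto 1).eventually_lt_const (u := 0) (by simpa using hj)
      filter_upwards [nhdsWithin_le_nhds this] with r hr _
      exact ⟨j, hr⟩
  have e3 : ∀ᶠ r : ℝ in nhdsWithin 1 {1}ᶜ, r ≠ 0 :=
    nhdsWithin_le_nhds (isOpen_ne.mem_nhds one_ne_zero)
  obtain ⟨r, h1, h2, h3⟩ := (e1.and (e2.and e3)).exists
  have hinj : Function.Injective fun x : ι → ℝ => r • x := smul_right_injective _ h3
  rw [← Finset.card_image_of_injective S hinj]
  refine card_le_of_sign_separated F hF g hg hgF _ ?_ ?_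
  · simpa using h1
  · simp only [Finset.mem_image, forall_exists_index, and_imp, forall_apply_eq_imp_iff₂]
    exact fun x hx y hy hxy => h2 x hx y hy fun h => hxy (h ▸ rfl)

/-- The `b`-th pencil encoded by a vector of coefficients. -/
def pencilCoeff {m q : ℕ} (θ : Fin 2 × Fin q × Fin m × Fin m → ℝ) (b : Fin 2) :
    Fin q → Matrix (Fin m) (Fin m) ℝ :=
  fun k => Matrix.of fun j l => θ (b, k, j, l)

/-- The difference of the largest eigenvalues of the two pencils encoded by `θ`, at `x`. -/
def eigDiff {m q : ℕ} (x : Fin q → ℝ) (θ : Fin 2 × Fin q × Fin m × Fin m → ℝ) : ℝ :=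
  lambdaMax (pencil (pencilCoeff θ 1) x) - lambdaMax (pencil (pencilCoeff θ 0) x)

lemma pencil_pencilCoeff_apply {m q : ℕ} (θ : Fin 2 × Fin q × Fin m × Fin m → ℝ) (b : Fin 2)
    (x : Fin q → ℝ) (j l : Fin m) :
    pencil (pencilCoeff θ b) x j l = ∑ k, x k * θ (b, k, j, l) := by
  simp [pencil, pencilCoeff, Matrix.sum_apply]

lemma eigDiff_smul {m q : ℕ} (hm : 0 < m) (x : Fin q → ℝ) {c : ℝ} (hc : 0 ≤ c)
    (θ : Fin 2 × Fin q × Fin m × Fin m → ℝ) : eigDiff x (c • θ) = c * eigDiff x θ := by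
  have h : ∀ b, pencil (pencilCoeff (c • θ) b) x = c • pencil (pencilCoeff θ b) x := by
    intro b
    ext j l
    simp [pencil_pencilCoeff_apply, Finset.mul_sum, mul_left_comm]
  simp only [eigDiff, h, lambdaMax_smul hm hc, mul_sub]

lemma continuous_eigDiff_uncurry {m q : ℕ} (hm : 0 < m) :
    Continuous fun p : (Fin q → ℝ) × (Fin 2 × Fin q × Fin m × Fin m → ℝ) =>
      eigDiff p.1 p.2 := by
  have h : ∀ b, Continuous fun p : (Fin q → ℝ) × (Fin 2 × Fin q × Fin m × Fin m → ℝ) =>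
      pencil (pencilCoeff p.2 b) p.1 := by
    refine fun b => continuous_pi fun j => continuous_pi fun l => ?_
    simp only [pencil_pencilCoeff_apply]
    fun_prop
  exact ((continuous_lambdaMax hm).comp (h 1)).sub ((continuous_lambdaMax hm).comp (h 0))

/-- The generic matrix whose evaluation at `θ` is the `b`-th pencil encoded by `θ`. -/
def pencilPoly {q : ℕ} (m : ℕ) (x : Fin q → ℝ) (b : Fin 2) :
    Matrix (Fin m) (Fin m) (MvPolynomial (Fin 2 × Fin q × Fin m × Fin m) ℝ) :=
  Matrix.of fun j l => ∑ k, MvPolynomial.C (x k) * MvPolynomial.X (b, k, j, l)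

/-- A polynomial in `θ` vanishing where `eigDiff x θ = t`. -/
def eigDiffPoly {q : ℕ} (m : ℕ) (x : Fin q → ℝ) (t : ℝ) :
    MvPolynomial (Fin 2 × Fin q × Fin m × Fin m) ℝ :=
  (sylvesterMatrix (pencilPoly m x 0 + (pencilPoly m x 0)ᵀ)
    (pencilPoly m x 1 + (pencilPoly m x 1)ᵀ -
      (MvPolynomial.C (2 * t) : MvPolynomial (Fin 2 × Fin q × Fin m × Fin m) ℝ) • 1)).det

lemma totalDegree_pencilPoly_le {q : ℕ} (m : ℕ) (x : Fin q → ℝ) (b : Fin 2) (j l : Fin m) :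
    (pencilPoly m x b j l).totalDegree ≤ 1 := by
  rw [pencilPoly, Matrix.of_apply]
  refine MvPolynomial.totalDegree_finsetSum_le fun k _ => ?_
  refine (MvPolynomial.totalDegree_mul _ _).trans ?_
  simp

lemma totalDegree_det_le {n σ : Type*} [Fintype n] [DecidableEq n] {R : Type*} [CommRing R]
    [Nontrivial R]
    (M : Matrix n n (MvPolynomial σ R)) (h : ∀ i j, (M i j).totalDegree ≤ 1) :
    M.det.totalDegree ≤ Fintype.card n := by
  rw [Matrix.det_apply]
  refine MvPolynomial.totalDegree_finsetSum_le fun s _ => ?_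
  refine (MvPolynomial.totalDegree_smul_le _ _).trans ?_
  refine (MvPolynomial.totalDegree_finsetProd _ _).trans ?_
  exact (Finset.sum_le_card_nsmul _ _ 1 fun j _ => h _ _).trans_eq (by simp)

lemma totalDegree_eigDiffPoly_le {q : ℕ} (m : ℕ) (x : Fin q → ℝ) (t : ℝ) :
    (eigDiffPoly m x t).totalDegree ≤ m ^ 2 := by
  refine (totalDegree_det_le _ fun p p' => ?_).trans_eq (by simp [sq])
  have hP : ∀ b j l, ((pencilPoly m x b + (pencilPoly m x b)ᵀ) j l).totalDegree ≤ 1 :=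
    fun b j l => (MvPolynomial.totalDegree_add _ _).trans
      (max_le (totalDegree_pencilPoly_le m x b j l) (totalDegree_pencilPoly_le m x b l j))
  have hmul : ∀ (f : MvPolynomial (Fin 2 × Fin q × Fin m × Fin m) ℝ) (P : Prop) [Decidable P],
      f.totalDegree ≤ 1 → (f * (if P then 1 else 0)).totalDegree ≤ 1 := by
    intro f P _ hf
    split_ifs <;> simp [hf]
  refine (MvPolynomial.totalDegree_sub _ _).trans (max_le (hmul _ _ (hP _ _ _)) ?_)
  rw [mul_comm]
  refine hmul _ _ ((MvPolynomial.totalDegree_sub _ _).trans (max_le (hP _ _ _) ?_))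
  rw [Matrix.smul_apply, Matrix.one_apply, smul_eq_mul]
  exact hmul _ _ ((MvPolynomial.totalDegree_C _).trans_le zero_le_one)

lemma eval_eigDiffPoly {q m : ℕ} (x : Fin q → ℝ) (t : ℝ)
    (θ : Fin 2 × Fin q × Fin m × Fin m → ℝ) :
    MvPolynomial.eval θ (eigDiffPoly m x t) =
      (sylvesterMatrix (pencil (pencilCoeff θ 0) x + (pencil (pencilCoeff θ 0) x)ᵀ)
        (pencil (pencilCoeff θ 1) x + (pencil (pencilCoeff θ 1) x)ᵀ - (2 * t) • 1)).det := by
  rw [eigDiffPoly, RingHom.map_det]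
  congr 1
  ext p p'
  simp only [sylvesterMatrix, pencilPoly, RingHom.mapMatrix_apply, Matrix.map_apply,
    Matrix.of_apply, Matrix.add_apply, Matrix.sub_apply, Matrix.smul_apply, Matrix.transpose_apply,
    Matrix.one_apply, pencil_pencilCoeff_apply, map_sub, map_add, map_mul, map_sum, smul_eq_mul,
    MvPolynomial.eval_C, MvPolynomial.eval_X, apply_ite (MvPolynomial.eval θ), map_one, map_zero]

lemma eval_zero_eigDiffPoly_ne_zero {q : ℕ} (m : ℕ) (x : Fin q → ℝ) {t : ℝ} (ht : t ≠ 0) :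
    MvPolynomial.eval 0 (eigDiffPoly m x t) ≠ 0 := by
  have h0 : ∀ b, pencil (pencilCoeff (0 : Fin 2 × Fin q × Fin m × Fin m → ℝ) b) x = 0 := by
    intro b
    ext j l
    simp [pencil_pencilCoeff_apply]
  rw [eval_eigDiffPoly, h0, h0]
  have h1 : sylvesterMatrix ((0 : Matrix (Fin m) (Fin m) ℝ) + (0 : Matrix (Fin m) (Fin m) ℝ)ᵀ)
      (0 + (0 : Matrix (Fin m) (Fin m) ℝ)ᵀ - (2 * t) • 1) = (2 * t) • 1 := by
    ext ⟨i, j⟩ ⟨i', j'⟩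
    by_cases h1 : i = i' <;> by_cases h2 : j = j' <;>
      simp [sylvesterMatrix, Matrix.one_apply, h1, h2]
  rw [h1, Matrix.det_smul]
  simp [ht]

lemma eval_eigDiffPoly_eq_zero {q m : ℕ} (hm : 0 < m) {x : Fin q → ℝ} {t : ℝ}
    {θ : Fin 2 × Fin q × Fin m × Fin m → ℝ} (h : eigDiff x θ - t = 0) :
    MvPolynomial.eval θ (eigDiffPoly m x t) = 0 := by
  rw [eval_eigDiffPoly]
  have h1 : lambdaMax (pencil (pencilCoeff θ 0) x) =
      lambdaMax (pencil (pencilCoeff θ 1) x - t • 1) := by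
    rw [lambdaMax_sub_smul_one hm]
    unfold eigDiff at h
    linarith
  rw [← det_sylvesterMatrix_eq_zero_of_lambdaMax_eq hm h1]
  congr 2
  ext i j
  by_cases hij : i = j
  · simp [hij]
    ring
  · simp [hij]

lemma card_le_of_eigDiff_separated_of_floor {n q m : ℕ} (hn : 0 < n) (x : Fin n → Fin q → ℝ)
    (S : Finset (Fin 2 × Fin q × Fin m × Fin m → ℝ))
    (hS : ∀ θ ∈ S, ∀ i, |eigDiff (x i) θ| ≤ 1)
    (hsep : ∀ θ ∈ S, ∀ θ' ∈ S, θ ≠ θ' →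
      ∃ i, 1 / (n : ℝ) ≤ |eigDiff (x i) θ - eigDiff (x i) θ'|) :
    S.card ≤ (2 * n + 1) ^ n := by
  classical
  have hn' : (0 : ℝ) < n := by exact_mod_cast hn
  have hcard : (Fintype.piFinset fun _ : Fin n => Finset.Icc (-(n : ℤ)) n).card
      = (2 * n + 1) ^ n := by
    rw [Fintype.card_piFinset]
    simp only [Int.card_Icc, Finset.prod_const, Finset.card_univ, Fintype.card_fin]
    congr 1
    omega
  rw [← hcard]
  refine Finset.card_le_card_of_injOn (fun θ i => ⌊n * eigDiff (x i) θ⌋) ?_ ?_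
  · intro θ hθ
    simp only [Finset.mem_coe, Fintype.mem_piFinset, Finset.mem_Icc]
    intro i
    have h := abs_le.mp (hS θ hθ i)
    constructor
    · rw [Int.le_floor]
      push_cast
      nlinarith
    · rw [← Int.floor_natCast (R := ℝ) n]
      exact Int.floor_le_floor (by nlinarith)
  · intro θ hθ θ' hθ' heq
    by_contra hne
    obtain ⟨i, hi⟩ := hsep θ hθ θ' hθ' hne
    have h1 := Int.abs_sub_lt_one_of_floor_eq_floor (congrFun heq i)
    rw [← mul_sub, abs_mul, abs_of_pos hn'] at h1
    rw [div_le_iff₀ hn'] at hi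
    linarith

lemma exists_threshold_between {n : ℕ} (hn : 0 < n) {a b : ℝ} (ha : -1 ≤ a) (hb : b ≤ 1)
    (hab : 1 / (n : ℝ) ≤ b - a) :
    ∃ j : Fin (4 * n + 1), a < (2 * ((j : ℝ) - 2 * n) + 1) / (4 * n) ∧
      (2 * ((j : ℝ) - 2 * n) + 1) / (4 * n) < b := by
  have hn' : (0 : ℝ) < n := by exact_mod_cast hn
  rw [div_le_iff₀ hn'] at hab
  set k : ℕ := ⌊(4 * n * (a + 1) + 1) / 2⌋₊ with hk
  have h0 : (0 : ℝ) ≤ (4 * n * (a + 1) + 1) / 2 := by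
    have : 0 ≤ n * (a + 1) := mul_nonneg hn'.le (by linarith)
    linarith
  have h1 : (k : ℝ) ≤ (4 * n * (a + 1) + 1) / 2 := Nat.floor_le h0
  have h2 : (4 * n * (a + 1) + 1) / 2 < (k : ℝ) + 1 := Nat.lt_floor_add_one _
  have hk1 : (k : ℝ) < 4 * n + 1 := by nlinarith
  have hk2 : k < 4 * n + 1 := by exact_mod_cast hk1
  refine ⟨⟨k, hk2⟩, ?_, ?_⟩
  · rw [lt_div_iff₀ (by positivity)]
    simp only
    nlinarith
  · rw [div_lt_iff₀ (by positivity)]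
    simp only
    nlinarith

lemma card_le_of_eigDiff_separated_of_threshold {n q m : ℕ} (hn : 0 < n) (hm : 0 < m)
    (x : Fin n → Fin q → ℝ)
    (S : Finset (Fin 2 × Fin q × Fin m × Fin m → ℝ))
    (hS : ∀ θ ∈ S, ∀ i, |eigDiff (x i) θ| ≤ 1)
    (hsep : ∀ θ ∈ S, ∀ θ' ∈ S, θ ≠ θ' →
      ∃ i, 1 / (n : ℝ) ≤ |eigDiff (x i) θ - eigDiff (x i) θ'|) :
    S.card ≤ (1 + 2 * (q * m ^ 2) * (2 * (n * (4 * n + 1) * m ^ 2) + 2)) ^ (2 * (q * m ^ 2)) := by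
  have hn' : (0 : ℝ) < n := by exact_mod_cast hn
  set t : Fin (4 * n + 1) → ℝ := fun j => (2 * ((j : ℝ) - 2 * n) + 1) / (4 * n) with ht
  have ht0 : ∀ j, t j ≠ 0 := by
    intro j
    refine div_ne_zero ?_ (by positivity)
    have : (2 * ((j : ℤ) - 2 * n) + 1 : ℤ) ≠ 0 := by omega
    exact_mod_cast this
  have hlt : ∀ i θ θ', θ ∈ S → θ' ∈ S →
      1 / (n : ℝ) ≤ eigDiff (x i) θ' - eigDiff (x i) θ →
      ∃ j, (eigDiff (x i) θ - t j) * (eigDiff (x i) θ' - t j) < 0 := by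
    intro i θ θ' hθ hθ' h
    obtain ⟨j, h1, h2⟩ := exists_threshold_between hn (abs_le.mp (hS θ hθ i)).1
      (abs_le.mp (hS θ' hθ' i)).2 h
    exact ⟨j, mul_neg_of_neg_of_pos (sub_neg.mpr h1) (sub_pos.mpr h2)⟩
  have key := card_le_of_sign_separated_family
    (J := Fin n × Fin (4 * n + 1)) (fun p => eigDiffPoly m (x p.1) (t p.2))
    (δ := m ^ 2) (fun p => totalDegree_eigDiffPoly_le m _ _)
    (fun p => eval_zero_eigDiffPoly_ne_zero m _ (ht0 p.2))
    (fun p θ => eigDiff (x p.1) θ - t p.2)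
    (fun p => ((continuous_eigDiff_uncurry hm).comp
      (Continuous.prodMk_right (x p.1))).sub continuous_const)
    (fun p θ h => eval_eigDiffPoly_eq_zero hm h) S ?_
  · simpa [sq] using key
  · intro θ hθ θ' hθ' hne
    obtain ⟨i, hi⟩ := hsep θ hθ θ' hθ' hne
    rcases le_abs.mp hi with h | h
    · obtain ⟨j, hj⟩ := hlt i θ' θ hθ' hθ h
      exact ⟨(i, j), by rwa [mul_comm]⟩
    · obtain ⟨j, hj⟩ := hlt i θ θ' hθ hθ' (by linarith)
      exact ⟨(i, j), hj⟩

lemma card_le_of_eigDiff_separated {n q m : ℕ} (hn : 16 ≤ n) (hm : 0 < m) (hq : 0 < q)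
    (x : Fin n → Fin q → ℝ)
    (S : Finset (Fin 2 × Fin q × Fin m × Fin m → ℝ))
    (hS : ∀ θ ∈ S, ∀ i, |eigDiff (x i) θ| ≤ 1)
    (hsep : ∀ θ ∈ S, ∀ θ' ∈ S, θ ≠ θ' →
      ∃ i, 1 / (n : ℝ) ≤ |eigDiff (x i) θ - eigDiff (x i) θ'|) :
    S.card ≤ n ^ (12 * (q * m ^ 2)) := by
  have hn0 : 0 < n := by omega
  set D := q * m ^ 2 with hD
  rcases le_total n D with h | h
  · calc S.card ≤ (2 * n + 1) ^ n := card_le_of_eigDiff_separated_of_floor hn0 x S hS hsep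
      _ ≤ (n ^ 2) ^ n := Nat.pow_le_pow_left (by nlinarith) n
      _ = n ^ (2 * n) := by rw [← pow_mul]
      _ ≤ n ^ (12 * D) := Nat.pow_le_pow_right hn0 (by omega)
  · have hmD : m ^ 2 ≤ n := (Nat.le_mul_of_pos_left _ hq).trans h
    calc S.card ≤ _ := card_le_of_eigDiff_separated_of_threshold hn0 hm x S hS hsep
      _ ≤ (n ^ 6) ^ (2 * D) := by
        refine Nat.pow_le_pow_left ?_ _
        calc 1 + 2 * D * (2 * (n * (4 * n + 1) * m ^ 2) + 2)
            ≤ 1 + 2 * n * (2 * (n * (4 * n + 1) * n) + 2) := by gcongr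
          _ ≤ n ^ 6 := by
            obtain ⟨k, rfl⟩ := Nat.exists_eq_add_of_le hn
            ring_nf
            nlinarith [sq_nonneg k, Nat.zero_le (k ^ 5), Nat.zero_le (k ^ 3), Nat.zero_le (k ^ 6),
              Nat.zero_le (k ^ 4)]
      _ = n ^ (12 * D) := by rw [← pow_mul]; ring_nf

lemma hasSubgaussianMGF_id_gaussianReal (v : ℝ≥0) :
    HasSubgaussianMGF (fun x : ℝ => x) v (gaussianReal 0 v) where
  integrable_exp_mul t := integrable_exp_mul_gaussianReal t
  mgf_le t := by simp [mgf_fun_id_gaussianReal]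

lemma measure_pi_gaussianReal_sum_ge_le {ι : Type*} [Fintype ι] (v : ℝ≥0) {a : ι → ℝ}
    (ha : ∑ i, a i ^ 2 = 1) {t : ℝ} (ht : 0 ≤ t) :
    (Measure.pi fun _ : ι => gaussianReal 0 v) {y | t ≤ ∑ i, a i * y i} ≤
      ENNReal.ofReal (Real.exp (-t ^ 2 / (2 * v))) := by
  have hind : iIndepFun (fun i (y : ι → ℝ) => a i * y i)
      (Measure.pi fun _ : ι => gaussianReal 0 v) :=
    iIndepFun_pi (X := fun i (z : ℝ) => a i * z) fun i => by fun_prop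
  let c : ι → ℝ≥0 := fun i => ⟨a i ^ 2, sq_nonneg (a i)⟩ * v
  have hsub : ∀ i ∈ Finset.univ, HasSubgaussianMGF (fun y : ι → ℝ => a i * y i)
      (c i) (Measure.pi fun _ : ι => gaussianReal 0 v) := by
    intro i _
    refine HasSubgaussianMGF.const_mul ?_ (a i)
    refine HasSubgaussianMGF.of_map (Y := fun y : ι → ℝ => y i) (X := fun x : ℝ => x)
      (measurable_pi_apply i).aemeasurable ?_
    rw [(measurePreserving_eval (fun _ : ι => gaussianReal 0 v) i).map_eq]
    exact hasSubgaussianMGF_id_gaussianReal v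
  have h := HasSubgaussianMGF.measure_sum_ge_le_of_iIndepFun hind hsub ht
  have hci : ∀ i, (c i : ℝ) = a i ^ 2 * v := fun i => rfl
  have hc : ((∑ i, c i : ℝ≥0) : ℝ) = v := by
    simp only [NNReal.coe_sum, hci, ← Finset.sum_mul, ha, one_mul]
  rw [hc] at h
  rw [← ofReal_measureReal]
  exact ENNReal.ofReal_le_ofReal h

/-- A maximal separated subset is a covering. -/
lemma exists_finset_card_le_covering {ι : Type*} {T : Set (ι → ℝ)} {δ : ℝ} (hδ : 0 < δ) {M : ℕ}
    (hM : ∀ S : Finset (ι → ℝ), (↑S : Set (ι → ℝ)) ⊆ T →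
      (∀ a ∈ S, ∀ b ∈ S, a ≠ b → ∃ i, δ ≤ |a i - b i|) → S.card ≤ M) :
    ∃ S : Finset (ι → ℝ), (↑S : Set (ι → ℝ)) ⊆ T ∧ S.card ≤ M ∧
      ∀ a ∈ T, ∃ b ∈ S, ∀ i, |a i - b i| < δ := by
  classical
  let P : ℕ → Prop := fun k => ∃ S : Finset (ι → ℝ), (↑S : Set (ι → ℝ)) ⊆ T ∧
    (∀ a ∈ S, ∀ b ∈ S, a ≠ b → ∃ i, δ ≤ |a i - b i|) ∧ S.card = k
  have h0 : P 0 := ⟨∅, by simp, by simp, by simp⟩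
  obtain ⟨S, hST, hsep, hcard⟩ : P (Nat.findGreatest P M) :=
    Nat.findGreatest_spec (Nat.zero_le M) h0
  refine ⟨S, hST, hM S hST hsep, fun a ha => ?_⟩
  by_contra! hfar
  have haS : a ∉ S := fun h => by
    obtain ⟨i, hi⟩ := hfar a h
    simp only [sub_self, abs_zero] at hi
    linarith
  have hT' : (↑(insert a S) : Set (ι → ℝ)) ⊆ T := by
    rw [Finset.coe_insert]
    exact Set.insert_subset ha hST
  have hsep' : ∀ b ∈ insert a S, ∀ c ∈ insert a S, b ≠ c → ∃ i, δ ≤ |b i - c i| := by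
    intro b hb c hc hbc
    rcases Finset.mem_insert.mp hb with rfl | hb' <;>
      rcases Finset.mem_insert.mp hc with rfl | hc'
    · exact absurd rfl hbc
    · exact hfar c hc'
    · obtain ⟨i, hi⟩ := hfar b hb'
      exact ⟨i, by rwa [abs_sub_comm]⟩
    · exact hsep b hb' c hc' hbc
  have h1 : (insert a S).card ≤ Nat.findGreatest P M :=
    Nat.le_findGreatest (hM _ hT' hsep') ⟨_, hT', hsep', rfl⟩
  rw [Finset.card_insert_of_notMem haS] at h1
  omega

lemma measure_pi_gaussianReal_exists_sum_gt_le {n : ℕ} (hn : 0 < n) (v : ℝ≥0)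
    {T : Set (Fin n → ℝ)} (hT : ∀ a ∈ T, ∑ i, a i ^ 2 = 1) {M : ℕ}
    (hM : ∀ S : Finset (Fin n → ℝ), (↑S : Set (Fin n → ℝ)) ⊆ T →
      (∀ a ∈ S, ∀ b ∈ S, a ≠ b → ∃ i, 1 / (n : ℝ) ≤ |a i - b i|) → S.card ≤ M)
    {t : ℝ} (ht : 0 ≤ t) :
    (Measure.pi fun _ : Fin n => gaussianReal 0 v) {y | ∃ a ∈ T, 2 * t < ∑ i, a i * y i} ≤
      ((M + 2 * n : ℕ) : ENNReal) * ENNReal.ofReal (Real.exp (-t ^ 2 / (2 * v))) := by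
  classical
  have hn' : (0 : ℝ) < n := by exact_mod_cast hn
  obtain ⟨S, hST, hcard, hcov⟩ := exists_finset_card_le_covering (one_div_pos.mpr hn') hM
  set E : ℝ → Finset (Fin n → ℝ) := fun c => Finset.univ.image fun i : Fin n => Pi.single i c
  have hE : ∀ c, (E c).card ≤ n := fun c => Finset.card_image_le.trans_eq (by simp)
  set G := S ∪ (E 1 ∪ E (-1))
  have hG : G.card ≤ M + 2 * n := by
    refine (Finset.card_union_le _ _).trans ?_
    have := Finset.card_union_le (E 1) (E (-1))
    have := hE 1
    have := hE (-1)
    omega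
  have hGs : ∀ a ∈ G, ∑ i, a i ^ 2 = 1 := by
    intro a ha
    rcases Finset.mem_union.mp ha with h | h
    · exact hT a (hST h)
    · rcases Finset.mem_union.mp h with h | h <;> obtain ⟨i, -, rfl⟩ := Finset.mem_image.mp h <;>
        simp [Pi.single_apply]
  have hsub : {y : Fin n → ℝ | ∃ a ∈ T, 2 * t < ∑ i, a i * y i} ⊆
      ⋃ a ∈ G, {y | t ≤ ∑ i, a i * y i} := by
    rintro y ⟨a, ha, hlt⟩
    by_contra hy
    simp only [Set.mem_iUnion, Set.mem_ofPred_eq, not_exists, not_le] at hy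
    have hyi : ∀ i, |y i| ≤ t := by
      intro i
      have h1 := hy (Pi.single i 1) (by simp [G, E])
      have h2 := hy (Pi.single i (-1)) (by simp [G, E])
      simp only [Pi.single_apply, ite_mul, zero_mul, Finset.sum_ite_eq', Finset.mem_univ,
        if_true] at h1 h2
      exact abs_le.mpr ⟨by linarith, by linarith⟩
    obtain ⟨b, hb, hab⟩ := hcov a ha
    have h3 := hy b (Finset.mem_union_left _ hb)
    have h4 : ∑ i, a i * y i - ∑ i, b i * y i ≤ ∑ _i : Fin n, 1 / (n : ℝ) * t := by
      rw [← Finset.sum_sub_distrib]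
      refine Finset.sum_le_sum fun i _ => ?_
      rw [← sub_mul]
      refine (le_abs_self _).trans ?_
      rw [abs_mul]
      exact mul_le_mul (hab i).le (hyi i) (abs_nonneg _) (by positivity)
    have h5 : ∑ _i : Fin n, 1 / (n : ℝ) * t = t := by
      rw [Finset.sum_const, Finset.card_univ, Fintype.card_fin, nsmul_eq_mul]
      field_simp
    linarith
  calc _ ≤ ∑ a ∈ G, (Measure.pi fun _ : Fin n => gaussianReal 0 v) {y | t ≤ ∑ i, a i * y i} :=
        (measure_mono hsub).trans (measure_biUnion_finset_le _ _)
    _ ≤ ∑ _a ∈ G, ENNReal.ofReal (Real.exp (-t ^ 2 / (2 * v))) :=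
        Finset.sum_le_sum fun a ha => measure_pi_gaussianReal_sum_ge_le v (hGs a ha) ht
    _ ≤ _ := by
        rw [Finset.sum_const, nsmul_eq_mul]
        gcongr

lemma continuous_eigDiff_left {α : Type*} [TopologicalSpace α] {q m : ℕ} (hm : 0 < m)
    (θ : Fin 2 × Fin q × Fin m × Fin m → ℝ) {f : α → Fin q → ℝ} (hf : Continuous f) :
    Continuous fun a => eigDiff (f a) θ := by
  have h : Continuous fun a => (f a, θ) := hf.prodMk continuous_const
  have h' := (continuous_eigDiff_uncurry hm).comp h
  exact h'

lemma measure_exists_sum_eigDiff_gt_le {n q m : ℕ} (hn : 16 ≤ n) (hm : 0 < m) (hq : 0 < q)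
    (x : Fin n → Fin q → ℝ) (v : ℝ≥0) {t : ℝ} (ht : 0 ≤ t) :
    (Measure.pi fun _ : Fin n => gaussianReal 0 v)
      {y | ∃ θ : Fin 2 × Fin q × Fin m × Fin m → ℝ,
        2 * t * √(∑ i, eigDiff (x i) θ ^ 2) < ∑ i, eigDiff (x i) θ * y i} ≤
      ((n ^ (13 * (q * m ^ 2)) : ℕ) : ENNReal) * ENNReal.ofReal (Real.exp (-t ^ 2 / (2 * v))) := by
  classical
  set T : Set (Fin n → ℝ) := {a | ∑ i, a i ^ 2 = 1 ∧
    ∃ θ : Fin 2 × Fin q × Fin m × Fin m → ℝ, ∀ i, eigDiff (x i) θ = a i} with hTdef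
  have hM : ∀ S : Finset (Fin n → ℝ), (↑S : Set (Fin n → ℝ)) ⊆ T →
      (∀ a ∈ S, ∀ b ∈ S, a ≠ b → ∃ i, 1 / (n : ℝ) ≤ |a i - b i|) →
      S.card ≤ n ^ (12 * (q * m ^ 2)) := by
    intro S hST hsep
    have hex : ∀ a : Fin n → ℝ, ∃ θ : Fin 2 × Fin q × Fin m × Fin m → ℝ,
        a ∈ S → ∀ i, eigDiff (x i) θ = a i := by
      intro a
      by_cases ha : a ∈ S
      · obtain ⟨θ, hθ⟩ := (hST ha).2
        exact ⟨θ, fun _ => hθ⟩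
      · exact ⟨0, fun h => absurd h ha⟩
    choose f hf using hex
    have hinj : Set.InjOn f S := by
      intro a ha b hb hab
      funext i
      rw [← hf a ha i, ← hf b hb i, hab]
    rw [← Finset.card_image_of_injOn hinj]
    refine card_le_of_eigDiff_separated hn hm hq x _ ?_ ?_
    · simp only [Finset.mem_image, forall_exists_index, and_imp, forall_apply_eq_imp_iff₂]
      intro a ha i
      rw [hf a ha i]
      exact abs_le_one_of_sum_sq_eq_one (hST ha).1 i
    · simp only [Finset.mem_image, forall_exists_index, and_imp, forall_apply_eq_imp_iff₂]
      intro a ha b hb hab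
      obtain ⟨i, hi⟩ := hsep a ha b hb fun h => hab (h ▸ rfl)
      exact ⟨i, by rwa [hf a ha i, hf b hb i]⟩
  have hsub : {y : Fin n → ℝ | ∃ θ : Fin 2 × Fin q × Fin m × Fin m → ℝ,
      2 * t * √(∑ i, eigDiff (x i) θ ^ 2) < ∑ i, eigDiff (x i) θ * y i} ⊆
      {y | ∃ a ∈ T, 2 * t < ∑ i, a i * y i} := by
    rintro y ⟨θ, hθ⟩
    set N := √(∑ i, eigDiff (x i) θ ^ 2) with hN
    have hnn : 0 ≤ ∑ i, eigDiff (x i) θ ^ 2 := Finset.sum_nonneg fun i _ => sq_nonneg _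
    have hN2 : N ^ 2 = ∑ i, eigDiff (x i) θ ^ 2 := Real.sq_sqrt hnn
    have hN0 : 0 < N := by
      refine (Real.sqrt_nonneg _).lt_of_ne' fun h0 => ?_
      rw [show N = 0 from h0, zero_pow two_ne_zero] at hN2
      have h1 := (Finset.sum_eq_zero_iff_of_nonneg fun i _ => sq_nonneg _).mp hN2.symm
      have h2 : ∀ i, eigDiff (x i) θ = 0 := fun i =>
        pow_eq_zero_iff two_ne_zero |>.mp (h1 i (Finset.mem_univ i))
      simp [h2, hN] at hθ
    refine ⟨fun i => N⁻¹ * eigDiff (x i) θ, ⟨?_, N⁻¹ • θ, fun i =>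
      eigDiff_smul hm _ (inv_nonneg.mpr hN0.le) θ⟩, ?_⟩
    · simp only [mul_pow, ← Finset.mul_sum, ← hN2]
      field_simp
    · simp only [mul_assoc, ← Finset.mul_sum]
      rw [lt_inv_mul_iff₀ hN0]
      linarith
  refine (measure_mono hsub).trans ((measure_pi_gaussianReal_exists_sum_gt_le (by omega) v
    (fun a ha => ha.1) hM ht).trans ?_)
  gcongr
  have hD : 0 < q * m ^ 2 := by positivity
  have h1 : n ≤ n ^ (12 * (q * m ^ 2)) := Nat.le_self_pow (by omega) n
  have h2 : n ^ (12 * (q * m ^ 2)) * n ≤ n ^ (13 * (q * m ^ 2)) := by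
    rw [← pow_succ]
    exact Nat.pow_le_pow_right (by omega) (by omega)
  nlinarith

lemma measure_prod_exists_sum_eigDiff_gt_le {Ω : Type*} [TopologicalSpace Ω]
    [SecondCountableTopology Ω] [MeasurableSpace Ω]
    [BorelSpace Ω] (μ : Measure Ω) [IsProbabilityMeasure μ] {n q m : ℕ} (hn : 16 ≤ n)
    (hm : 0 < m) (hq : 0 < q) {x : Ω → Fin n → Fin q → ℝ} (hx : Continuous x) (v : ℝ≥0)
    {t : ℝ} (ht : 0 ≤ t) :
    (μ.prod (Measure.pi fun _ : Fin n => gaussianReal 0 v))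
      {ω | ∃ θ : Fin 2 × Fin q × Fin m × Fin m → ℝ,
        2 * t * √(∑ i, eigDiff (x ω.1 i) θ ^ 2) < ∑ i, eigDiff (x ω.1 i) θ * ω.2 i} ≤
      ((n ^ (13 * (q * m ^ 2)) : ℕ) : ENNReal) * ENNReal.ofReal (Real.exp (-t ^ 2 / (2 * v))) := by
  have hmeas : MeasurableSet {ω : Ω × (Fin n → ℝ) | ∃ θ : Fin 2 × Fin q × Fin m × Fin m → ℝ,
      2 * t * √(∑ i, eigDiff (x ω.1 i) θ ^ 2) < ∑ i, eigDiff (x ω.1 i) θ * ω.2 i} := by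
    refine IsOpen.measurableSet ?_
    simp only [Set.ofPred_exists]
    refine isOpen_iUnion fun θ => ?_
    have hc : ∀ i, Continuous fun ω : Ω × (Fin n → ℝ) => eigDiff (x ω.1 i) θ := by
      intro i
      have hxi : Continuous fun ω : Ω × (Fin n → ℝ) => x ω.1 i :=
        (continuous_apply i).comp (hx.comp continuous_fst)
      exact continuous_eigDiff_left hm θ hxi
    exact isOpen_lt (by fun_prop) (by fun_prop)
  rw [Measure.prod_apply hmeas]
  calc _ ≤ ∫⁻ _ : Ω, ((n ^ (13 * (q * m ^ 2)) : ℕ) : ENNReal) *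
        ENNReal.ofReal (Real.exp (-t ^ 2 / (2 * v))) ∂μ :=
        lintegral_mono fun ω => measure_exists_sum_eigDiff_gt_le hn hm hq (x ω) v ht
    _ = _ := by simp

lemma natCast_pow_mul_ofReal_exp_le {n D : ℕ} (hn : 0 < n) {v : ℝ≥0} (hv : 0 < v) {t : ℝ}
    (ht : t ^ 2 = 28 * v * D * Real.log n) :
    ((n ^ (13 * D) : ℕ) : ENNReal) * ENNReal.ofReal (Real.exp (-t ^ 2 / (2 * v))) =
      ENNReal.ofReal (Real.exp (-D * Real.log n)) := by
  have hn' : (0 : ℝ) < n := by exact_mod_cast hn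
  have hv' : (0 : ℝ) < v := hv
  rw [← ENNReal.ofReal_natCast, ← ENNReal.ofReal_mul (Nat.cast_nonneg _)]
  congr 1
  have h1 : ((n ^ (13 * D) : ℕ) : ℝ) = Real.exp (13 * D * Real.log n) := by
    rw [← Real.exp_log (show (0 : ℝ) < ((n ^ (13 * D) : ℕ) : ℝ) by positivity)]
    push_cast
    rw [Real.log_pow]
    push_cast
    rfl
  rw [h1, ← Real.exp_add]
  congr 1
  rw [ht]
  field_simp
  ring

lemma le_lambda2 {m : ℕ} (A : Matrix (Fin m) (Fin m) ℝ) {r : ℝ}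
    (h : ∀ w0 : Fin m → ℝ, ∃ z : Fin m → ℝ, 0 < ∑ i, z i ^ 2 ∧ ∑ i, z i * w0 i = 0 ∧
      r * ∑ i, z i ^ 2 ≤ rayleigh A z) : r ≤ lambda2 A := by
  refine le_csInf ⟨_, 0, rfl⟩ ?_
  rintro _ ⟨w0, rfl⟩
  obtain ⟨z, hz, hzw, hr⟩ := h w0
  set N := ∑ i, z i ^ 2 with hN
  have hs : √N ^ 2 = N := Real.sq_sqrt hz.le
  refine le_csSup_of_le (b := rayleigh A ((√N)⁻¹ • z)) ?_
    ⟨(√N)⁻¹ • z, ?_, ?_, rfl⟩ ?_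
  · refine (bddAbove_rayleigh A).mono ?_
    rintro _ ⟨v, hv, -, rfl⟩
    exact ⟨v, hv, rfl⟩
  · simp only [Pi.smul_apply, smul_eq_mul, mul_pow, ← Finset.mul_sum, inv_pow, hs]
    exact inv_mul_cancel₀ hz.ne'
  · simp only [Pi.smul_apply, smul_eq_mul, mul_assoc, ← Finset.mul_sum, hzw, mul_zero]
  · rw [rayleigh_smul_vec, inv_pow, hs, le_inv_mul_iff₀ hz]
    linarith

lemma rayleigh_add_smul_of_mulVec_eq {m : ℕ} {M : Matrix (Fin m) (Fin m) ℝ} (hM : M.IsSymm)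
    {u w : Fin m → ℝ} {c : ℝ} (hu : u ⬝ᵥ u = 1) (hMu : M *ᵥ u = c • u) (huw : u ⬝ᵥ w = 0)
    (a b : ℝ) : rayleigh M (a • u + b • w) = a ^ 2 * c + b ^ 2 * rayleigh M w := by
  have h1 : u ⬝ᵥ (M *ᵥ w) = 0 := by
    rw [Matrix.dotProduct_mulVec, ← Matrix.mulVec_transpose, hM.eq, hMu, smul_dotProduct, huw,
      smul_zero]
  simp only [rayleigh_eq_dotProduct, Matrix.mulVec_add, Matrix.mulVec_smul, add_dotProduct,
    dotProduct_add, smul_dotProduct, dotProduct_smul, smul_eq_mul, h1, hMu, hu,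
    dotProduct_comm w u, huw]
  ring

/-- A spectral gap is stable under perturbation of the quadratic form. -/
lemma rayleigh_le_of_gap {m : ℕ} (hm : 0 < m) {M Mstar : Matrix (Fin m) (Fin m) ℝ}
    (hM : M.IsSymm) {u : Fin m → ℝ} (hu : ∑ i, u i ^ 2 = 1)
    (hMu : M *ᵥ u = lambdaMax M • u) {δ κ : ℝ}
    (hδ : ∀ v, |rayleigh M v - rayleigh Mstar v| ≤ δ * ∑ i, v i ^ 2)
    (hκ : κ ≤ lambdaMax Mstar - lambda2 Mstar) {w : Fin m → ℝ} (huw : u ⬝ᵥ w = 0) :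
    rayleigh M w ≤ (lambdaMax M - (κ - 2 * δ)) * ∑ i, w i ^ 2 := by
  by_contra! hlt
  rw [sum_sq_eq_dotProduct] at hu
  have hmax : lambdaMax Mstar ≤ lambdaMax M + δ := by
    refine lambdaMax_le hm fun v hv => ?_
    have h1 := (abs_le.mp (hδ v)).1
    have h2 := rayleigh_le_lambdaMax M hv
    rw [hv] at h1
    linarith
  have hw0 : 0 < ∑ i, w i ^ 2 := by
    refine (Finset.sum_nonneg fun i _ => sq_nonneg (w i)).lt_of_ne' fun h => ?_
    have := rayleigh_le_lambdaMax_mul M w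
    rw [h] at this hlt
    linarith
  set N := ∑ i, w i ^ 2 with hN
  set ρ := rayleigh M w / N with hρ
  have hρN : ρ * N = rayleigh M w := div_mul_cancel₀ _ hw0.ne'
  have hρ1 : lambdaMax M - (κ - 2 * δ) < ρ := (lt_div_iff₀ hw0).mpr hlt
  have hρ2 : ρ ≤ lambdaMax M := (div_le_iff₀ hw0).mpr (rayleigh_le_lambdaMax_mul M w)
  have h2 : ρ - δ ≤ lambda2 Mstar := by
    refine le_lambda2 _ fun w0 => ?_
    obtain ⟨a, b, hab, h0⟩ : ∃ a b : ℝ, 0 < a ^ 2 + b ^ 2 ∧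
        a * (u ⬝ᵥ w0) + b * (w ⬝ᵥ w0) = 0 := by
      by_cases h : u ⬝ᵥ w0 = 0
      · exact ⟨1, 0, by norm_num, by rw [h]; ring⟩
      · exact ⟨w ⬝ᵥ w0, -(u ⬝ᵥ w0), by
          linarith [sq_nonneg (w ⬝ᵥ w0), sq_pos_of_ne_zero (neg_ne_zero.mpr h)], by ring⟩
    have hz : ∑ i, (a • u + b • w) i ^ 2 = a ^ 2 + b ^ 2 * N := by
      rw [hN, sum_sq_eq_dotProduct, sum_sq_eq_dotProduct]
      simp only [add_dotProduct, dotProduct_add, smul_dotProduct, dotProduct_smul, smul_eq_mul,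
        hu, dotProduct_comm w u, huw]
      ring
    refine ⟨a • u + b • w, ?_, ?_, ?_⟩
    · rw [hz]
      rcases eq_or_ne b 0 with rfl | hb
      · simpa using hab
      · positivity
    · change (a • u + b • w) ⬝ᵥ w0 = 0
      rw [add_dotProduct, smul_dotProduct, smul_dotProduct]
      exact h0
    · have h3 := (abs_le.mp (hδ (a • u + b • w))).2
      rw [rayleigh_add_smul_of_mulVec_eq hM hu hMu huw, hz, ← hρN] at h3
      rw [hz]
      have := mul_le_mul_of_nonneg_left hρ2 (sq_nonneg a)
      linarith
  linarith

/-- The largest eigenvalue is differentiable at a matrix with a spectral gap. -/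
lemma exists_lambdaMax_add_smul_bounds {m : ℕ} (hm : 0 < m) {M : Matrix (Fin m) (Fin m) ℝ}
    (hM : M.IsSymm) {u : Fin m → ℝ} (hu : ∑ i, u i ^ 2 = 1)
    (hMu : M *ᵥ u = lambdaMax M • u) {γ : ℝ} (hγ : 0 < γ)
    (hgap : ∀ w, u ⬝ᵥ w = 0 → rayleigh M w ≤ (lambdaMax M - γ) * ∑ i, w i ^ 2)
    (C : Matrix (Fin m) (Fin m) ℝ) :
    ∃ K : ℝ, ∀ s : ℝ, 0 ≤ s → s * rayleigh C u ≤ lambdaMax (M + s • C) - lambdaMax M ∧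
      lambdaMax (M + s • C) - lambdaMax M ≤ s * rayleigh C u + K * s ^ 2 := by
  have hu' : u ⬝ᵥ u = 1 := by rwa [sum_sq_eq_dotProduct] at hu
  have hMr : rayleigh M u = lambdaMax M := by
    rw [rayleigh_eq_dotProduct, hMu, dotProduct_smul, hu', smul_eq_mul, mul_one]
  set L := ∑ i, ∑ j, |C i j| with hL
  refine ⟨4 * L ^ 2 / γ, fun s hs => ⟨?_, ?_⟩⟩
  · have h := rayleigh_le_lambdaMax (M + s • C) hu
    rw [rayleigh_add, rayleigh_smul, hMr] at h
    linarith
  · suffices h : lambdaMax (M + s • C) ≤ lambdaMax M + s * rayleigh C u + 4 * L ^ 2 / γ * s ^ 2 by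
      linarith
    refine lambdaMax_le hm fun v hv => ?_
    set α := u ⬝ᵥ v with hα
    set r := v - α • u with hr
    have hur : u ⬝ᵥ r = 0 := by
      rw [hr, dotProduct_sub, dotProduct_smul, hu', ← hα, smul_eq_mul, mul_one, sub_self]
    have hvr : v = α • u + (1 : ℝ) • r := by rw [hr, one_smul]; abel
    set β2 := ∑ i, r i ^ 2 with hβ2
    have hβ0 : 0 ≤ β2 := Finset.sum_nonneg fun i _ => sq_nonneg _
    have hαβ : α ^ 2 + β2 = 1 := by
      rw [sum_sq_eq_dotProduct, hvr] at hv
      rw [hβ2, sum_sq_eq_dotProduct, ← hv]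
      simp only [add_dotProduct, dotProduct_add, smul_dotProduct, dotProduct_smul, smul_eq_mul,
        hu', dotProduct_comm r u, hur]
      ring
    set β := √β2 with hβ
    have hββ : β ^ 2 = β2 := Real.sq_sqrt hβ0
    have hβn : 0 ≤ β := Real.sqrt_nonneg _
    have hβ1 : β ≤ 1 := by nlinarith [sq_nonneg α]
    have hα1 : |α| ≤ 1 := (sq_le_one_iff_abs_le_one α).mp (by linarith)
    have hri : ∀ i, |r i| ≤ β := fun i => by
      refine Real.abs_le_sqrt ?_
      exact Finset.single_le_sum (f := fun i => r i ^ 2) (fun i _ => sq_nonneg (r i))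
        (Finset.mem_univ i)
    have hui := abs_le_one_of_sum_sq_eq_one hu
    have h1 : rayleigh M v ≤ lambdaMax M - γ * β ^ 2 := by
      have hgr := hgap r hur
      rw [hvr, rayleigh_add_smul_of_mulVec_eq hM hu' hMu hur, hββ]
      rw [← hβ2] at hgr
      have : α ^ 2 = 1 - β2 := by linarith
      rw [this]
      linarith
    have h2 : rayleigh C v - rayleigh C u ≤ 4 * β * L := by
      have hij : ∀ i j, |v i * v j - u i * u j| ≤ 4 * β := by
        intro i j
        have e : v i * v j - u i * u j =
            α * u i * r j + r i * (α * u j) + r i * r j - β2 * u i * u j := by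
          rw [hvr]
          simp only [Pi.add_apply, Pi.smul_apply, smul_eq_mul, one_mul]
          linear_combination (u i * u j) * hαβ
        have b1 : |α * u i * r j| ≤ 1 * 1 * β := by
          rw [abs_mul, abs_mul]
          gcongr
          exacts [hui i, hri j]
        have b2 : |r i * (α * u j)| ≤ β * (1 * 1) := by
          rw [abs_mul, abs_mul]
          gcongr
          exacts [hri i, hui j]
        have b3 : |r i * r j| ≤ β * 1 := by
          rw [abs_mul]
          gcongr
          exacts [hri i, (hri j).trans hβ1]
        have b4 : |β2 * u i * u j| ≤ β * 1 * 1 := by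
          rw [abs_mul, abs_mul, abs_of_nonneg hβ0]
          gcongr
          · nlinarith
          · exact hui i
          · exact hui j
        rw [e]
        rw [abs_le] at *
        constructor <;> linarith
      calc rayleigh C v - rayleigh C u
          = ∑ i, ∑ j, (v i * v j - u i * u j) * C i j := by
            simp only [rayleigh, ← Finset.sum_sub_distrib]
            refine Finset.sum_congr rfl fun i _ => Finset.sum_congr rfl fun j _ => by ring
        _ ≤ ∑ i, ∑ j, 4 * β * |C i j| := by
            refine Finset.sum_le_sum fun i _ => Finset.sum_le_sum fun j _ => ?_
            refine (le_abs_self _).trans ?_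
            rw [abs_mul]
            exact mul_le_mul_of_nonneg_right (hij i j) (abs_nonneg _)
        _ = 4 * β * L := by simp only [hL, Finset.mul_sum]
    rw [rayleigh_add, rayleigh_smul]
    have h3 : s * (4 * β * L) ≤ γ * β ^ 2 + 4 * L ^ 2 / γ * s ^ 2 := by
      have h4 : γ * β ^ 2 + 4 * L ^ 2 / γ * s ^ 2 - s * (4 * β * L) =
          (γ * β - 2 * L * s) ^ 2 / γ := by
        field_simp
        ring
      have h5 : 0 ≤ (γ * β - 2 * L * s) ^ 2 / γ := by positivity
      linarith
    have h6 := mul_le_mul_of_nonneg_left h2 hs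
    linarith

lemma pencil_smul {m q : ℕ} (A : Fin q → Matrix (Fin m) (Fin m) ℝ) (c : ℝ) (x : Fin q → ℝ) :
    pencil A (c • x) = c • pencil A x := by
  simp [pencil, Finset.smul_sum, smul_smul]

lemma pencil_isSymm {m q : ℕ} {A : Fin q → Matrix (Fin m) (Fin m) ℝ} (hA : ∀ i, (A i).IsSymm)
    (x : Fin q → ℝ) : (pencil A x).IsSymm := by
  unfold pencil Matrix.IsSymm
  rw [Matrix.transpose_sum]
  exact Finset.sum_congr rfl fun i _ => by rw [Matrix.transpose_smul, (hA i).eq]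

lemma rayleigh_pencil {m q : ℕ} (A : Fin q → Matrix (Fin m) (Fin m) ℝ) (x : Fin q → ℝ)
    (v : Fin m → ℝ) : rayleigh (pencil A x) v = ∑ p : Fin q × Fin m × Fin m,
      x p.1 * (v p.2.1 * v p.2.2) * A p.1 p.2.1 p.2.2 := by
  simp only [Fintype.sum_prod_type, rayleigh, pencil, Matrix.sum_apply, Matrix.smul_apply,
    smul_eq_mul, Finset.mul_sum, Finset.sum_mul]
  rw [Finset.sum_congr rfl fun i _ => Finset.sum_comm, Finset.sum_comm]
  exact Finset.sum_congr rfl fun k _ => Finset.sum_congr rfl fun i _ =>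
    Finset.sum_congr rfl fun j _ => by ring

lemma abs_rayleigh_pencil_sub_le {m q : ℕ} (A B : Fin q → Matrix (Fin m) (Fin m) ℝ)
    {x : Fin q → ℝ} (hx : ∑ i, x i ^ 2 = 1) (v : Fin m → ℝ) :
    |rayleigh (pencil A x) v - rayleigh (pencil B x) v| ≤
      frobP (fun i => A i - B i) * ∑ i, v i ^ 2 := by
  have hN : 0 ≤ ∑ i, v i ^ 2 := Finset.sum_nonneg fun i _ => sq_nonneg _
  refine abs_le_of_sq_le_sq ?_ (mul_nonneg (Real.sqrt_nonneg _) hN)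
  rw [rayleigh_pencil, rayleigh_pencil, ← Finset.sum_sub_distrib]
  simp only [← mul_sub]
  refine (Finset.sum_mul_sq_le_sq_mul_sq _ _ _).trans_eq ?_
  rw [mul_pow, frobP, Real.sq_sqrt (by positivity), mul_comm]
  congr 1
  · simp only [Fintype.sum_prod_type, Matrix.sub_apply]
  · simp only [Fintype.sum_prod_type, mul_pow, ← Finset.mul_sum, ← Finset.sum_mul, hx]
    ring

lemma le_gap_of_sInf_eq {m q : ℕ} {A : Fin q → Matrix (Fin m) (Fin m) ℝ} {κ : ℝ} (hκ : 0 < κ)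
    (h : sInf {r : ℝ | ∃ u : Fin q → ℝ, (∑ i, u i ^ 2) = 1 ∧
      r = lambdaMax (pencil A u) - lambda2 (pencil A u)} = κ)
    {x : Fin q → ℝ} (hx : ∑ i, x i ^ 2 = 1) :
    κ ≤ lambdaMax (pencil A x) - lambda2 (pencil A x) := by
  rw [← h]
  refine csInf_le ?_ ⟨x, hx, rfl⟩
  by_contra hb
  rw [Real.sInf_of_not_bddBelow hb] at h
  exact hκ.ne h

lemma exists_gap_of_frobP_le {m q : ℕ} (hm : 0 < m) {A Astar : Fin q → Matrix (Fin m) (Fin m) ℝ}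
    (hA : ∀ i, (A i).IsSymm) {κ : ℝ} (hκ : 0 < κ)
    (h : sInf {r : ℝ | ∃ u : Fin q → ℝ, (∑ i, u i ^ 2) = 1 ∧
      r = lambdaMax (pencil Astar u) - lambda2 (pencil Astar u)} = κ)
    (hball : frobP (fun i => A i - Astar i) ≤ κ / 4) {x : Fin q → ℝ} (hx : x ≠ 0)
    {u : Fin m → ℝ} (hu : ∑ i, u i ^ 2 = 1)
    (hAu : pencil A x *ᵥ u = lambdaMax (pencil A x) • u) :
    ∃ γ : ℝ, 0 < γ ∧ ∀ w, u ⬝ᵥ w = 0 →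
      rayleigh (pencil A x) w ≤ (lambdaMax (pencil A x) - γ) * ∑ i, w i ^ 2 := by
  set N := √(∑ i, x i ^ 2) with hNdef
  have hpos : 0 < ∑ i, x i ^ 2 := by
    obtain ⟨i, hi⟩ := Function.ne_iff.mp hx
    exact Finset.sum_pos' (fun i _ => sq_nonneg _)
      ⟨i, Finset.mem_univ i, sq_pos_of_ne_zero hi⟩
  have hN : 0 < N := Real.sqrt_pos.mpr hpos
  have he : ∑ i, (N⁻¹ • x) i ^ 2 = 1 := by
    simp only [Pi.smul_apply, smul_eq_mul, mul_pow, ← Finset.mul_sum, inv_pow]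
    rw [hNdef, Real.sq_sqrt hpos.le]
    exact inv_mul_cancel₀ hpos.ne'
  have hNi : 0 ≤ N⁻¹ := (inv_pos.mpr hN).le
  have hAe : pencil A (N⁻¹ • x) *ᵥ u = lambdaMax (pencil A (N⁻¹ • x)) • u := by
    rw [pencil_smul, lambdaMax_smul hm hNi, Matrix.smul_mulVec, hAu, smul_smul]
  refine ⟨N * (κ / 2), by positivity, fun w hw => ?_⟩
  have hgap := rayleigh_le_of_gap hm (pencil_isSymm hA _) hu hAe (δ := κ / 4)
    (fun v => (abs_rayleigh_pencil_sub_le A Astar he v).trans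
      (mul_le_mul_of_nonneg_right hball (Finset.sum_nonneg fun i _ => sq_nonneg _)))
    (le_gap_of_sInf_eq hκ h he) hw
  rw [pencil_smul, rayleigh_smul, lambdaMax_smul hm hNi, inv_mul_le_iff₀ hN] at hgap
  refine hgap.trans_eq ?_
  field_simp
  ring

/-- The coefficient vector encoding the pair of pencils `(A, A + s • C)`. -/
def pencilPair {m q : ℕ} (A : Fin q → Matrix (Fin m) (Fin m) ℝ) (c : Fin q × Fin m × Fin m → ℝ)
    (s : ℝ) : Fin 2 × Fin q × Fin m × Fin m → ℝ :=
  fun p => A p.2.1 p.2.2.1 p.2.2.2 + (if p.1 = 0 then 0 else s * c p.2)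

lemma eigDiff_pencilPair {m q : ℕ} (A : Fin q → Matrix (Fin m) (Fin m) ℝ)
    (c : Fin q × Fin m × Fin m → ℝ) (s : ℝ) (x : Fin q → ℝ) :
    eigDiff x (pencilPair A c s) =
      lambdaMax (pencil A x + s • pencil (fun k => Matrix.of fun j l => c (k, j, l)) x) -
        lambdaMax (pencil A x) := by
  have h0 : pencil (pencilCoeff (pencilPair A c s) 0) x = pencil A x := by
    ext j l
    rw [pencil_pencilCoeff_apply]
    simp [pencilPair, pencil, Matrix.sum_apply]
  have h1 : pencil (pencilCoeff (pencilPair A c s) 1) x =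
      pencil A x + s • pencil (fun k => Matrix.of fun j l => c (k, j, l)) x := by
    ext j l
    rw [pencil_pencilCoeff_apply]
    simp only [pencilPair, pencil, Matrix.sum_apply, Matrix.add_apply,
      Matrix.smul_apply, smul_eq_mul, Matrix.of_apply, one_ne_zero, if_false, Finset.mul_sum,
      mul_add, Finset.sum_add_distrib]
    congr 1
    exact Finset.sum_congr rfl fun k _ => by ring
  rw [eigDiff, h0, h1]

lemma rayleigh_pencil_eq_XiMat_mulVec {d m n : ℕ} (xi : Fin n → Fin (d + 1) → ℝ)
    (u : Fin n → Fin m → ℝ) (c : Fin (d + 1) × Fin m × Fin m → ℝ) (i : Fin n) :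
    rayleigh (pencil (fun k => Matrix.of fun j l => c (k, j, l)) (xi i)) (u i) =
      (XiMat xi u *ᵥ c) i := by
  simp [rayleigh_pencil, XiMat, Matrix.mulVec, dotProduct]

open Filter Topology in
lemma tendsto_inv_mul_eigDiff_pencilPair {m q : ℕ} (hm : 0 < m)
    {A Astar : Fin q → Matrix (Fin m) (Fin m) ℝ}
    (hA : ∀ i, (A i).IsSymm) {κ : ℝ} (hκ : 0 < κ)
    (h : sInf {r : ℝ | ∃ u : Fin q → ℝ, (∑ i, u i ^ 2) = 1 ∧
      r = lambdaMax (pencil Astar u) - lambda2 (pencil Astar u)} = κ)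
    (hball : frobP (fun i => A i - Astar i) ≤ κ / 4) {x : Fin q → ℝ} (hx : x ≠ 0)
    {u : Fin m → ℝ} (hu : ∑ i, u i ^ 2 = 1)
    (hAu : pencil A x *ᵥ u = lambdaMax (pencil A x) • u) (c : Fin q × Fin m × Fin m → ℝ) :
    Tendsto (fun s : ℝ => s⁻¹ * eigDiff x (pencilPair A c s)) (𝓝[>] 0)
      (𝓝 (rayleigh (pencil (fun k => Matrix.of fun j l => c (k, j, l)) x) u)) := by
  obtain ⟨γ, hγ, hgap⟩ := exists_gap_of_frobP_le hm hA hκ h hball hx hu hAu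
  set C := pencil (fun k => Matrix.of fun j l => c (k, j, l)) x with hC
  obtain ⟨K, hK⟩ := exists_lambdaMax_add_smul_bounds hm (pencil_isSymm hA x) hu hAu hγ hgap C
  have hlim : Tendsto (fun s : ℝ => rayleigh C u + K * s) (𝓝[>] 0) (𝓝 (rayleigh C u)) := by
    have hc : Continuous fun s : ℝ => rayleigh C u + K * s := by fun_prop
    simpa using (hc.tendsto 0).mono_left nhdsWithin_le_nhds
  refine tendsto_of_tendsto_of_tendsto_of_le_of_le' tendsto_const_nhds hlim ?_ ?_
  · filter_upwards [self_mem_nhdsWithin] with s hs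
    rw [eigDiff_pencilPair, le_inv_mul_iff₀ hs]
    exact (hK s (le_of_lt hs)).1
  · filter_upwards [self_mem_nhdsWithin] with s hs
    rw [eigDiff_pencilPair, inv_mul_le_iff₀ hs]
    exact (hK s (le_of_lt hs)).2.trans_eq (by ring)

open Filter Topology in
lemma exists_sum_eigDiff_gt {d m n : ℕ} (hm : 0 < m)
    {A Astar : Fin (d + 1) → Matrix (Fin m) (Fin m) ℝ}
    (hA : ∀ i, (A i).IsSymm) {κ : ℝ} (hκ : 0 < κ)
    (h : sInf {r : ℝ | ∃ u : Fin (d + 1) → ℝ, (∑ i, u i ^ 2) = 1 ∧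
      r = lambdaMax (pencil Astar u) - lambda2 (pencil Astar u)} = κ)
    (hball : frobP (fun i => A i - Astar i) ≤ κ / 4)
    {xi : Fin n → Fin (d + 1) → ℝ} (hxi : ∀ i, xi i ≠ 0) {u : Fin n → Fin m → ℝ}
    (hu : ∀ i, ∑ j, u i j ^ 2 = 1 ∧
      pencil A (xi i) *ᵥ u i = lambdaMax (pencil A (xi i)) • u i)
    {P : Matrix (Fin n) (Fin n) ℝ} (hPs : P.IsSymm) (hPP : P * P = P)
    (hP : ∀ y : Fin n → ℝ, ∃ c, P *ᵥ y = XiMat xi u *ᵥ c) {y : Fin n → ℝ} {t : ℝ}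
    (hy : 4 * t ^ 2 < ∑ i, (P *ᵥ y) i ^ 2) :
    ∃ θ : Fin 2 × Fin (d + 1) × Fin m × Fin m → ℝ,
      2 * t * √(∑ i, eigDiff (xi i) θ ^ 2) < ∑ i, eigDiff (xi i) θ * y i := by
  obtain ⟨c, hc⟩ := hP y
  set f := P *ᵥ y with hf
  have hlim : ∀ i, Tendsto (fun s : ℝ => s⁻¹ * eigDiff (xi i) (pencilPair A c s)) (𝓝[>] 0)
      (𝓝 (f i)) := by
    intro i
    rw [hc, ← rayleigh_pencil_eq_XiMat_mulVec]
    exact tendsto_inv_mul_eigDiff_pencilPair hm hA hκ h hball (hxi i) (hu i).1 (hu i).2 c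
  have hfy : ∑ i, f i * y i = ∑ i, f i ^ 2 := by
    rw [sum_sq_eq_dotProduct]
    change f ⬝ᵥ y = f ⬝ᵥ f
    conv_rhs => rw [hf, Matrix.dotProduct_mulVec, ← Matrix.mulVec_transpose, hPs.eq,
      Matrix.mulVec_mulVec, hPP]
  have hlt : 2 * t * √(∑ i, f i ^ 2) < ∑ i, f i * y i := by
    rw [hfy]
    have h0 : 0 < ∑ i, f i ^ 2 := lt_of_le_of_lt (by positivity) hy
    have h1 : 2 * t < √(∑ i, f i ^ 2) := Real.lt_sqrt_of_sq_lt (by linarith)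
    nlinarith [Real.sq_sqrt h0.le, Real.sqrt_pos.mpr h0]
  have hL : Tendsto (fun s : ℝ =>
      2 * t * √(∑ i, (s⁻¹ * eigDiff (xi i) (pencilPair A c s)) ^ 2)) (𝓝[>] 0)
      (𝓝 (2 * t * √(∑ i, f i ^ 2))) :=
    (tendsto_finsetSum _ fun i _ => (hlim i).pow 2).sqrt.const_mul _
  have hR : Tendsto (fun s : ℝ =>
      ∑ i, s⁻¹ * eigDiff (xi i) (pencilPair A c s) * y i) (𝓝[>] 0) (𝓝 (∑ i, f i * y i)) :=
    tendsto_finsetSum _ fun i _ => (hlim i).mul_const _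
  obtain ⟨s, hs, hs0⟩ := ((hL.eventually_lt hR hlt).and self_mem_nhdsWithin).exists
  refine ⟨s⁻¹ • pencilPair A c s, ?_⟩
  simpa only [eigDiff_smul hm _ (inv_nonneg.mpr (le_of_lt hs0))] using hs

lemma snoc_one_ne_zero {d : ℕ} (x : Fin d → ℝ) :
    (Fin.snoc x 1 : Fin (d + 1) → ℝ) ≠ 0 := fun h => by
  have := congrFun h (Fin.last d)
  simp at this

lemma four_mul_lt_of_sq_eq {n D : ℕ} (hn : 16 ≤ n) (hD : 0 < D) {σ : ℝ} (hσ : 0 < σ) {t : ℝ}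
    (ht : t ^ 2 = 28 * σ ^ 2 * D * Real.log n) :
    4 * t ^ 2 < 113 * Real.log n ^ 2 * σ ^ 2 * D := by
  have hn' : (16 : ℝ) ≤ n := by exact_mod_cast hn
  have hlog : 1 < Real.log n := by
    rw [Real.lt_log_iff_exp_lt (by linarith)]
    linarith [Real.exp_one_lt_d9]
  have hpos : 0 < σ ^ 2 * D * Real.log n := by positivity
  rw [ht]
  nlinarith

/-- Uniform bound on the projected noise over the ball of pencils around `𝒜_*`. -/
theorem projection_noise_bound :
    ∃ c0 c1 c2 : ℝ, 0 < c0 ∧ 0 < c1 ∧ 0 < c2 ∧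
      ∀ d m n : ℕ, 0 < d → 0 < m → 0 < n →
      ∀ σ κ : ℝ, 0 < σ → 0 < κ →
      ∀ Astar : Fin (d + 1) → Matrix (Fin m) (Fin m) ℝ, (∀ i, (Astar i).IsSymm) →
      sInf {r : ℝ | ∃ u : Fin (d + 1) → ℝ, (∑ i, u i ^ 2) = 1 ∧
          r = lambdaMax (pencil Astar u) - lambda2 (pencil Astar u)} = κ →
      (n : ℝ) ≥ c0 →
      ((Measure.pi fun _ : Fin n => Measure.pi fun _ : Fin d => gaussianReal 0 1).prod
          (Measure.pi fun _ : Fin n => gaussianReal 0 ⟨σ ^ 2, sq_nonneg σ⟩))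
        {ω : (Fin n → Fin d → ℝ) × (Fin n → ℝ) |
          c1 * Real.log (n : ℝ) ^ 2 * σ ^ 2 * (m : ℝ) ^ 2 * ((d : ℝ) + 1) ≤
            sSup {s : ℝ |
              ∃ A : Fin (d + 1) → Matrix (Fin m) (Fin m) ℝ, (∀ i, (A i).IsSymm) ∧
                frobP (fun i => A i - Astar i) ≤ κ / 4 ∧
              ∃ u : Fin n → Fin m → ℝ,
                (∀ i, (∑ j, u i j ^ 2) = 1 ∧
                  (pencil A (Fin.snoc (ω.1 i) 1)).mulVec (u i) =
                    lambdaMax (pencil A (Fin.snoc (ω.1 i) 1)) • u i) ∧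
              ∃ Pr : Matrix (Fin n) (Fin n) ℝ, Pr.IsSymm ∧ Pr * Pr = Pr ∧
                (∀ cvec : Fin (d + 1) × Fin m × Fin m → ℝ,
                  Pr.mulVec ((XiMat (fun i => Fin.snoc (ω.1 i) 1) u).mulVec cvec) =
                    (XiMat (fun i => Fin.snoc (ω.1 i) 1) u).mulVec cvec) ∧
                (∀ v : Fin n → ℝ, ∃ cvec : Fin (d + 1) × Fin m × Fin m → ℝ,
                  Pr.mulVec v = (XiMat (fun i => Fin.snoc (ω.1 i) 1) u).mulVec cvec) ∧
                s = ∑ i, (Pr.mulVec ω.2 i) ^ 2}} ≤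
        ENNReal.ofReal (Real.exp (-c2 * ((d : ℝ) + 1) * (m : ℝ) ^ 2 * Real.log (n : ℝ))) := by
  refine ⟨16, 113, 1, by norm_num, by norm_num, one_pos, ?_⟩
  intro d m n _ hm hn0 σ κ hσ hκ Astar _ hgap hn
  have hn16 : 16 ≤ n := by exact_mod_cast hn
  have hD : 0 < (d + 1) * m ^ 2 := by positivity
  set v : ℝ≥0 := ⟨σ ^ 2, sq_nonneg σ⟩ with hv
  have hv0 : 0 < v := show (0 : ℝ) < σ ^ 2 by positivity
  set t := √(28 * σ ^ 2 * ((d + 1) * m ^ 2 : ℕ) * Real.log n) with ht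
  have ht0 : 0 ≤ t := Real.sqrt_nonneg _
  have ht2 : t ^ 2 = 28 * σ ^ 2 * ((d + 1) * m ^ 2 : ℕ) * Real.log n :=
    Real.sq_sqrt (mul_nonneg (by positivity) (Real.log_natCast_nonneg n))
  have hcont : Continuous fun (X : Fin n → Fin d → ℝ) (i : Fin n) =>
      (Fin.snoc (X i) 1 : Fin (d + 1) → ℝ) :=
    continuous_pi fun i => (continuous_apply i).finSnoc continuous_const
  have hprob := measure_prod_exists_sum_eigDiff_gt_le
    (Measure.pi fun _ : Fin n => Measure.pi fun _ : Fin d => gaussianReal 0 1)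
    hn16 hm d.succ_pos hcont v ht0
  rw [natCast_pow_mul_ofReal_exp_le hn0 hv0 ht2] at hprob
  refine (measure_mono fun ω hω => ?_).trans (hprob.trans_eq ?_)
  · by_contra hno
    have hle := four_mul_lt_of_sq_eq hn16 hD hσ ht2
    rw [Set.mem_ofPred_eq] at hω
    have hsup := hω.trans (Real.sSup_le (a := 4 * t ^ 2) ?_ (by positivity))
    · push_cast at hle
      linarith
    · rintro s ⟨A, hA, hball, u, hu, P, hPs, hPP, -, hP, rfl⟩
      by_contra! hlt
      exact hno (exists_sum_eigDiff_gt hm hA hκ hgap hball (fun i => snoc_one_ne_zero _) hu hPs hPP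
        hP hlt)
  · congr 2
    push_cast
    ring
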